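/- arXiv:1805.00982 — 12 statements merged into one kernel-verified Lean document; each statement's English description precedes it below -/
import Mathlib

section
/- Let each f_i be convex and L-smooth, let f be μ-strongly convex with unique minimizer x*, and let α_1,…,α_n ∈ E with ᾱ = (1/n)·Σ_{i=1}^n α_i. Then for every x ∈ E and every stepsize η > 0: (1/n)·Σ_{i=1}^n ‖x − η(∇f_i(x) − α_i + ᾱ) − x*‖² ≤ (1 − ημ)·‖x − x*‖² + (2η²/n)·Σ_{i=1}^n ‖α_i − ∇f_i(x*)‖² − 2η(1 − 2ηL)·(f(x) − f(x*)). (This is the paper's Lemma 3: a single variance-reduced stochastic gradient step, with the expectation over the uniformly random index i written as the average over i = 1,…,n.) -/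
open RealInnerProductSpace

section Gradient

variable {E : Type*} [NormedAddCommGroup E] [InnerProductSpace ℝ E] [CompleteSpace E]

lemma HasGradientAt.hasDerivAt_add_smul {f : E → ℝ} {f' x d : E} {t : ℝ}
    (h : HasGradientAt f f' (x + t • d)) :
    HasDerivAt (fun s : ℝ => f (x + s • d)) ⟪f', d⟫ t := by
  have hline : HasDerivAt (fun s : ℝ => x + s • d) d t := by
    simpa using ((hasDerivAt_id t).smul_const d).const_add x
  exact (hasGradientAt_iff_hasFDerivAt.mp h).comp_hasDerivAt t hline

lemma ConvexOn.add_inner_gradient_le {f : E → ℝ} (hf : ConvexOn ℝ Set.univ f) {f' x : E}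
    (h : HasGradientAt f f' x) (y : E) : f x + ⟪f', y - x⟫ ≤ f y := by
  have hconv : ConvexOn ℝ Set.univ (fun s : ℝ => f (x + s • (y - x))) := by
    simpa [Function.comp_def, AffineMap.lineMap_apply, add_comm] using
      hf.comp_affineMap (AffineMap.lineMap x y : ℝ →ᵃ[ℝ] E)
  have hderiv : HasDerivAt (fun s : ℝ => f (x + s • (y - x))) ⟪f', y - x⟫ 0 :=
    HasGradientAt.hasDerivAt_add_smul (by simpa using h)
  have hslope := hconv.le_slope_of_hasDerivAt (Set.mem_univ 0) (Set.mem_univ 1) one_pos hderiv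
  simp [slope_def_field] at hslope
  linarith

/-- The descent lemma. -/
lemma le_add_inner_gradient_add_sq {f : E → ℝ} {g : E → E} {L : ℝ}
    (hgrad : ∀ x, HasGradientAt f (g x) x)
    (hsmooth : ∀ x y, ‖g x - g y‖ ≤ L * ‖x - y‖) (x y : E) :
    f y ≤ f x + ⟪g x, y - x⟫ + L / 2 * ‖y - x‖ ^ 2 := by
  set d := y - x with hd
  have hderiv (t : ℝ) : HasDerivAt
      (fun s : ℝ => f (x + s • d) - s * ⟪g x, d⟫ - L / 2 * ‖d‖ ^ 2 * s ^ 2)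
      (⟪g (x + t • d), d⟫ - ⟪g x, d⟫ - L * ‖d‖ ^ 2 * t) t := by
    refine (((hgrad (x + t • d)).hasDerivAt_add_smul.sub
      ((hasDerivAt_id t).mul_const ⟪g x, d⟫)).sub
        ((hasDerivAt_pow 2 t).const_mul (L / 2 * ‖d‖ ^ 2))).congr_deriv ?_
    push_cast
    ring
  have hanti : AntitoneOn
      (fun s : ℝ => f (x + s • d) - s * ⟪g x, d⟫ - L / 2 * ‖d‖ ^ 2 * s ^ 2) (Set.Icc 0 1) := by
    refine antitoneOn_of_deriv_nonpos (convex_Icc 0 1)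
      (fun t _ => (hderiv t).continuousAt.continuousWithinAt)
      (fun t _ => (hderiv t).differentiableAt.differentiableWithinAt) fun t ht => ?_
    rw [interior_Icc] at ht
    rw [(hderiv t).deriv, ← inner_sub_left]
    have hlip : ‖g (x + t • d) - g x‖ ≤ L * (t * ‖d‖) := by
      simpa [norm_smul, abs_of_pos ht.1] using hsmooth (x + t • d) x
    nlinarith [real_inner_le_norm (g (x + t • d) - g x) d,
      mul_le_mul_of_nonneg_right hlip (norm_nonneg d)]
  have h := hanti (Set.left_mem_Icc.mpr zero_le_one) (Set.right_mem_Icc.mpr zero_le_one)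
    zero_le_one
  have hy : x + d = y := by simp [hd]
  simp [hy] at h
  linarith

lemma ConvexOn.norm_gradient_sub_sq_le {f : E → ℝ} (hf : ConvexOn ℝ Set.univ f) {g : E → E}
    {L : ℝ} (hL : 0 < L) (hgrad : ∀ x, HasGradientAt f (g x) x)
    (hsmooth : ∀ x y, ‖g x - g y‖ ≤ L * ‖x - y‖) (x y : E) :
    ‖g y - g x‖ ^ 2 ≤ 2 * L * (f y - f x - ⟪g x, y - x⟫) := by
  have hlower := hf.add_inner_gradient_le (hgrad x) (y - L⁻¹ • (g y - g x))
  have hupper := le_add_inner_gradient_add_sq hgrad hsmooth y (y - L⁻¹ • (g y - g x))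
  have hdiff : y - L⁻¹ • (g y - g x) - x = (y - x) - L⁻¹ • (g y - g x) := by abel
  have hdir : y - L⁻¹ • (g y - g x) - y = -(L⁻¹ • (g y - g x)) := by abel
  rw [hdiff, inner_sub_right, real_inner_smul_right] at hlower
  rw [hdir, inner_neg_right, real_inner_smul_right, norm_neg, norm_smul, mul_pow,
    Real.norm_eq_abs, sq_abs] at hupper
  have hsq : ⟪g y, g y - g x⟫ - ⟪g x, g y - g x⟫ = ‖g y - g x‖ ^ 2 := by
    rw [← inner_sub_left, real_inner_self_eq_norm_sq]
  have hcoef : L / 2 * (L⁻¹ ^ 2 * ‖g y - g x‖ ^ 2) = L⁻¹ * ‖g y - g x‖ ^ 2 / 2 := by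
    field_simp
  have hbound : L⁻¹ * ‖g y - g x‖ ^ 2 / 2 ≤ f y - f x - ⟪g x, y - x⟫ := by
    have hsq' := congrArg (L⁻¹ * ·) hsq
    simp only [mul_sub] at hsq'
    linarith
  calc ‖g y - g x‖ ^ 2 = 2 * L * (L⁻¹ * ‖g y - g x‖ ^ 2 / 2) := by field_simp
    _ ≤ _ := by gcongr

lemma sum_gradient_eq_zero_of_forall_sum_le {ι : Type*} [Fintype ι] {f : ι → E → ℝ} {g : ι → E}
    {x : E} (hgrad : ∀ i, HasGradientAt (f i) (g i) x)
    (hmin : ∀ y, ∑ i, f i x ≤ ∑ i, f i y) : ∑ i, g i = 0 := by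
  have hsum := HasFDerivAt.fun_sum (u := Finset.univ)
    fun i _ => hasGradientAt_iff_hasFDerivAt.mp (hgrad i)
  have hloc : IsLocalMin (fun y => ∑ i, f i y) x := Filter.Eventually.of_forall hmin
  have hzero := hloc.hasFDerivAt_eq_zero hsum
  rwa [← map_sum, map_eq_zero_iff _ (InnerProductSpace.toDual ℝ E).injective] at hzero

end Gradient

lemma norm_add_sq_le_two_mul {E : Type*} [NormedAddCommGroup E] [InnerProductSpace ℝ E]
    (a b : E) : ‖a + b‖ ^ 2 ≤ 2 * ‖a‖ ^ 2 + 2 * ‖b‖ ^ 2 := by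
  nlinarith [parallelogram_law_with_norm ℝ a b, sq_nonneg ‖a - b‖]

/-- The second moment about the mean is at most the second moment. -/
lemma sum_norm_sub_sq_le_of_sum_eq {E ι : Type*} [NormedAddCommGroup E] [InnerProductSpace ℝ E]
    [Fintype ι] (b : ι → E) {m : E} (hm : ∑ i, b i = (Fintype.card ι : ℝ) • m) :
    ∑ i, ‖b i - m‖ ^ 2 ≤ ∑ i, ‖b i‖ ^ 2 := by
  have h : ∑ i, ‖b i - m‖ ^ 2 = ∑ i, ‖b i‖ ^ 2 - Fintype.card ι * ‖m‖ ^ 2 := by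
    simp only [norm_sub_sq_real, Finset.sum_add_distrib, Finset.sum_sub_distrib,
      ← Finset.mul_sum, ← sum_inner, hm, real_inner_smul_left, real_inner_self_eq_norm_sq]
    simp
    ring
  rw [h]
  exact sub_le_self _ (by positivity)

/-- Lemma 3: a single variance-reduced stochastic gradient step, with the expectation
over the uniformly random index `i` written as the average over `i = 1,…,n`. -/
theorem kSVRG_single_step {E : Type*} [NormedAddCommGroup E] [InnerProductSpace ℝ E] [CompleteSpace E]
    (n : ℕ) (hn : 0 < n) (L μ : ℝ) (hL : 0 < L) (hμ : 0 < μ)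
    (f : Fin n → E → ℝ) (g : Fin n → E → E)
    (hgrad : ∀ i x, HasGradientAt (f i) (g i x) x)
    (hconv : ∀ i, ConvexOn ℝ Set.univ (f i))
    (hsmooth : ∀ i x y, ‖g i x - g i y‖ ≤ L * ‖x - y‖)
    (F : E → ℝ) (hF : ∀ x, F x = (1 / (n : ℝ)) * ∑ i, f i x)
    (G : E → E) (hG : ∀ x, G x = (1 / (n : ℝ)) • ∑ i, g i x)
    (hstrong : ∀ x y, F y ≥ F x + ⟪G x, y - x⟫ + (μ / 2) * ‖y - x‖ ^ 2)
    (xstar : E) (hmin : ∀ y, F xstar ≤ F y)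
    (α : Fin n → E) (αbar : E) (hαbar : αbar = (1 / (n : ℝ)) • ∑ i, α i)
    (x : E) (η : ℝ) (hη : 0 < η) :
    (1 / (n : ℝ)) * ∑ i, ‖x - η • (g i x - α i + αbar) - xstar‖ ^ 2 ≤
      (1 - η * μ) * ‖x - xstar‖ ^ 2
        + (2 * η ^ 2 / (n : ℝ)) * ∑ i, ‖α i - g i xstar‖ ^ 2
        - 2 * η * (1 - 2 * η * L) * (F x - F xstar) := by
  have hn' : (0 : ℝ) < n := by exact_mod_cast hn
  have hsumF (y : E) : ∑ i, f i y = n * F y := by rw [hF]; field_simp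
  have hsumG (y : E) : ∑ i, g i y = (n : ℝ) • G y := by
    rw [hG, smul_smul, mul_one_div_cancel hn'.ne', one_smul]
  have hsumα : ∑ i, α i = (n : ℝ) • αbar := by
    rw [hαbar, smul_smul, mul_one_div_cancel hn'.ne', one_smul]
  have hopt : ∑ i, g i xstar = 0 :=
    sum_gradient_eq_zero_of_forall_sum_le (fun i => hgrad i xstar) fun y => by
      rw [hsumF, hsumF]; exact mul_le_mul_of_nonneg_left (hmin y) hn'.le
  have hgap : ∑ i, ‖g i x - g i xstar‖ ^ 2 ≤ 2 * L * (n * (F x - F xstar)) := by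
    calc ∑ i, ‖g i x - g i xstar‖ ^ 2
        ≤ ∑ i, 2 * L * (f i x - f i xstar - ⟪g i xstar, x - xstar⟫) :=
          Finset.sum_le_sum fun i _ =>
            (hconv i).norm_gradient_sub_sq_le hL (hgrad i) (hsmooth i) xstar x
      _ = 2 * L * (n * (F x - F xstar)) := by
          rw [← Finset.mul_sum, Finset.sum_sub_distrib, Finset.sum_sub_distrib, ← sum_inner,
            hopt, hsumF, hsumF, inner_zero_left]
          ring
  have hvar : ∑ i, ‖α i - g i xstar - αbar‖ ^ 2 ≤ ∑ i, ‖α i - g i xstar‖ ^ 2 :=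
    sum_norm_sub_sq_le_of_sum_eq _ (by simp [Finset.sum_sub_distrib, hopt, hsumα])
  have hmoment : ∑ i, ‖g i x - α i + αbar‖ ^ 2 ≤
      2 * (2 * L * (n * (F x - F xstar))) + 2 * ∑ i, ‖α i - g i xstar‖ ^ 2 := by
    calc ∑ i, ‖g i x - α i + αbar‖ ^ 2
        ≤ ∑ i, (2 * ‖g i x - g i xstar‖ ^ 2 + 2 * ‖α i - g i xstar - αbar‖ ^ 2) :=
          Finset.sum_le_sum fun i _ => by
            have h := norm_add_sq_le_two_mul (g i x - g i xstar) (-(α i - g i xstar - αbar))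
            rw [norm_neg] at h
            have hsplit : g i x - α i + αbar =
                g i x - g i xstar + -(α i - g i xstar - αbar) := by abel
            rwa [hsplit]
      _ ≤ _ := by
          rw [Finset.sum_add_distrib, ← Finset.mul_sum, ← Finset.mul_sum]
          linarith
  have hmean : ∑ i, (g i x - α i + αbar) = (n : ℝ) • G x := by
    simp [Finset.sum_add_distrib, Finset.sum_sub_distrib, hsumG, hsumα, ← Nat.cast_smul_eq_nsmul ℝ]
  have hexpand : ∑ i, ‖x - η • (g i x - α i + αbar) - xstar‖ ^ 2 =
      n * ‖x - xstar‖ ^ 2 - 2 * η * (n * ⟪G x, x - xstar⟫)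
        + η ^ 2 * ∑ i, ‖g i x - α i + αbar‖ ^ 2 := by
    have hterm (i : Fin n) : ‖x - η • (g i x - α i + αbar) - xstar‖ ^ 2 =
        ‖x - xstar‖ ^ 2 - 2 * η * ⟪g i x - α i + αbar, x - xstar⟫
          + η ^ 2 * ‖g i x - α i + αbar‖ ^ 2 := by
      rw [sub_right_comm, norm_sub_sq_real, real_inner_smul_right, norm_smul, mul_pow,
        Real.norm_eq_abs, sq_abs, real_inner_comm]
      ring
    simp only [hterm, Finset.sum_add_distrib, Finset.sum_sub_distrib, ← Finset.mul_sum,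
      ← sum_inner, hmean, real_inner_smul_left]
    simp
  have hstrong_gap : F x - F xstar + μ / 2 * ‖x - xstar‖ ^ 2 ≤ ⟪G x, x - xstar⟫ := by
    have h := hstrong x xstar
    rw [← neg_sub x xstar, inner_neg_right, norm_neg] at h
    linarith
  rw [hexpand]
  calc (1 / (n : ℝ)) * (n * ‖x - xstar‖ ^ 2 - 2 * η * (n * ⟪G x, x - xstar⟫)
        + η ^ 2 * ∑ i, ‖g i x - α i + αbar‖ ^ 2)
      ≤ (1 / (n : ℝ)) * (n * ‖x - xstar‖ ^ 2
          - 2 * η * (n * (F x - F xstar + μ / 2 * ‖x - xstar‖ ^ 2))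
          + η ^ 2 * (2 * (2 * L * (n * (F x - F xstar)))
            + 2 * ∑ i, ‖α i - g i xstar‖ ^ 2)) := by gcongr
    _ = _ := by
        field_simp
        ring
end

section
/- (Lemma 2, variant V1, for a fixed point.) Let H_1,…,H_n ∈ ℝ with H = (1/n)·Σ_{i=1}^n H_i, let L > 0, and let Q_ℓ = Σ_{t=0}^{ℓ−1} (1 − 1/n)^t. Then for every x ∈ E: n^{−ℓ}·Σ_{ω ∈ {1,…,n}^ℓ} (1/n)·Σ_{i=1}^n [2L·h_i(x) if the index i occurs among the entries of ω, and H_i otherwise] = (2L·Q_ℓ/n)·(f(x) − f(x*)) + (1 − 1/n)^ℓ·H. (This is the expectation, over ℓ indices sampled uniformly with replacement from {1,…,n}, of the block update of the stored bounds H_i.) -/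
open RealInnerProductSpace

/-- The expected value of a two-valued update depending on whether `i` occurs among `l` uniform
samples with replacement from `Fin n`. -/
theorem average_ite_mem_image (n : ℕ) (hn : 0 < n) (l : ℕ) (i : Fin n) (a b : ℝ) :
    (1 / (n : ℝ) ^ l) * ∑ ω : Fin l → Fin n,
        (if i ∈ Finset.image ω Finset.univ then a else b) =
      (1 - (1 - 1 / (n : ℝ)) ^ l) * a + (1 - 1 / (n : ℝ)) ^ l * b := by
  have hn' : (n : ℝ) ≠ 0 := by positivity
  have hite : ∀ ω : Fin l → Fin n,
      (if i ∈ Finset.image ω Finset.univ then a else b) =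
        a + (b - a) * ∏ k, (1 - if ω k = i then (1 : ℝ) else 0) := by
    intro ω
    split_ifs with hi
    · obtain ⟨k, -, hk⟩ := Finset.mem_image.mp hi
      rw [Finset.prod_eq_zero (Finset.mem_univ k) (by simp [hk])]
      ring
    · have hne : ∀ k, ω k ≠ i := fun k hk =>
        hi (Finset.mem_image.mpr ⟨k, Finset.mem_univ k, hk⟩)
      simp [hne]
  have havoid : ∑ ω : Fin l → Fin n, ∏ k, (1 - if ω k = i then (1 : ℝ) else 0) =
      ((n : ℝ) - 1) ^ l := by
    rw [← Fintype.sum_pow (fun j : Fin n => 1 - if j = i then (1 : ℝ) else 0) l]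
    simp
  have hratio : (1 - 1 / (n : ℝ)) ^ l = ((n : ℝ) - 1) ^ l / (n : ℝ) ^ l := by
    rw [← div_pow, sub_div, div_self hn']
  simp_rw [hite]
  rw [Finset.sum_add_distrib, ← Finset.mul_sum, havoid, hratio]
  simp
  field_simp
  ring

/-- Lemma 2, variant V1, for a fixed point: expectation (over `ℓ` indices sampled
uniformly with replacement from `{1,…,n}`) of the block update of the stored bounds. -/
theorem kSVRG_H_update_V1 {E : Type*} [NormedAddCommGroup E]
    [InnerProductSpace ℝ E] [CompleteSpace E]
    (n : ℕ) (hn : 0 < n) (L : ℝ) (hL : 0 < L)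
    (f : Fin n → E → ℝ) (g : Fin n → E → E)
    (hgrad : ∀ i x, HasGradientAt (f i) (g i x) x)
    (F : E → ℝ) (hF : ∀ x, F x = (1 / (n : ℝ)) * ∑ i, f i x)
    (xstar : E) (hstat : ∑ i, g i xstar = 0)
    (h : Fin n → E → ℝ)
    (hh : ∀ i x, h i x = f i x - f i xstar - ⟪x - xstar, g i xstar⟫)
    (H : Fin n → ℝ) (Hbar : ℝ) (hHbar : Hbar = (1 / (n : ℝ)) * ∑ i, H i)
    (l : ℕ) (Q : ℝ) (hQ : Q = ∑ t ∈ Finset.range l, (1 - 1 / (n : ℝ)) ^ t)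
    (x : E) :
    (1 / (n : ℝ) ^ l) * ∑ ω : Fin l → Fin n,
        ((1 / (n : ℝ)) * ∑ i,
          (if i ∈ Finset.image ω Finset.univ then 2 * L * h i x else H i)) =
      (2 * L * Q / (n : ℝ)) * (F x - F xstar) + (1 - 1 / (n : ℝ)) ^ l * Hbar := by
  have hsum : (1 / (n : ℝ)) * ∑ i, h i x = F x - F xstar := by
    simp only [hh, hF, Finset.sum_sub_distrib, ← inner_sum, hstat, inner_zero_right]
    ring
  have hgeom : 1 - (1 - 1 / (n : ℝ)) ^ l = Q * (1 / (n : ℝ)) := by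
    rw [hQ, ← geom_sum_mul_neg, sub_sub_cancel]
  rw [← Finset.mul_sum, Finset.sum_comm, mul_left_comm, Finset.mul_sum]
  simp_rw [average_ite_mem_image n hn]
  rw [Finset.sum_add_distrib, ← Finset.mul_sum, ← Finset.mul_sum, ← Finset.mul_sum, hgeom,
    ← hsum, hHbar]
  ring
end

section
/- (Condition 1 in the proof of Theorem 1.) Let L, μ > 0 be reals, let n, ℓ, q be positive integers with q ≤ n, and let σ ∈ (0,1]. If 0 < η ≤ σ·(q/ℓ)/(μn + 2L), then, with γ = ηn/L and S_ℓ = Σ_{t=0}^{ℓ−1} (1 − ημ)^t, one has γσ(1 − q/n) + 2η²·S_ℓ ≤ γσ·(1 − ημ)^ℓ. -/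
/-- Condition 1 in the proof of Theorem 1. -/
theorem kSVRG_V2_condition1 (L μ : ℝ) (hL : 0 < L) (hμ : 0 < μ)
    (n l q : ℕ) (hn : 0 < n) (hl : 0 < l) (hq : 0 < q) (hqn : q ≤ n)
    (σ : ℝ) (hσ0 : 0 < σ) (hσ1 : σ ≤ 1)
    (η : ℝ) (hη0 : 0 < η) (hη : η ≤ σ * ((q : ℝ) / (l : ℝ)) / (μ * n + 2 * L))
    (γ : ℝ) (hγ : γ = η * n / L)
    (S : ℝ) (hS : S = ∑ t ∈ Finset.range l, (1 - η * μ) ^ t) :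
    γ * σ * (1 - (q : ℝ) / (n : ℝ)) + 2 * η ^ 2 * S ≤ γ * σ * (1 - η * μ) ^ l := by
  subst hγ hS
  have hn' : (0 : ℝ) < n := by exact_mod_cast hn
  have hl' : (1 : ℝ) ≤ l := by exact_mod_cast hl
  have hl0 : (0 : ℝ) < l := by linarith
  have hqn' : (q : ℝ) ≤ n := by exact_mod_cast hqn
  have hstep : η * l * (μ * n + 2 * L) ≤ σ * q := by
    rw [le_div_iff₀ (by positivity), mul_div_assoc', le_div_iff₀ hl0] at hη
    linarith
  have hσq : σ * q ≤ n := (mul_le_of_le_one_left (Nat.cast_nonneg q) hσ1).trans hqn'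
  have hημ : 0 < η * μ := mul_pos hη0 hμ
  have hημl : η * μ * l ≤ 1 := by
    have : 0 < η * l * L := by positivity
    refine le_of_mul_le_mul_right ?_ hn'
    linarith
  have hημ1 : η * μ ≤ 1 := (le_mul_of_one_le_right hημ.le hl').trans hημl
  have hsum : ∑ t ∈ Finset.range l, (1 - η * μ) ^ t ≤ l := by
    simpa using Finset.sum_le_card_nsmul (Finset.range l) (fun t => (1 - η * μ) ^ t) 1
      fun t _ => pow_le_one₀ (by linarith) (by linarith)
  have hbernoulli : 1 - l * (η * μ) ≤ (1 - η * μ) ^ l := by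
    simpa [sub_eq_add_neg] using one_add_mul_le_pow (a := -(η * μ)) (by linarith) l
  have hkey : 2 * η * l * L ≤ σ * (q - η * μ * l * n) := by
    have : σ * (η * μ * l * n) ≤ η * μ * l * n :=
      mul_le_of_le_one_left (by positivity) hσ1
    linarith
  calc η * n / L * σ * (1 - (q : ℝ) / n) + 2 * η ^ 2 * ∑ t ∈ Finset.range l, (1 - η * μ) ^ t
      ≤ η * n / L * σ * (1 - (q : ℝ) / n) + η / L * (2 * η * l * L) := by
        have : η / L * (2 * η * l * L) = 2 * η ^ 2 * l := by field_simp
        rw [this]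
        gcongr
    _ ≤ η * n / L * σ * (1 - (q : ℝ) / n) + η / L * (σ * (q - η * μ * l * n)) := by gcongr
    _ = η * n / L * σ * (1 - l * (η * μ)) := by
        field_simp
        ring
    _ ≤ η * n / L * σ * (1 - η * μ) ^ l := by gcongr
end

section
/- (Condition 2 in the proof of Theorem 1.) Let L, μ > 0 be reals, let n, ℓ, q be positive integers with q ≤ n, and let σ ∈ (0,1]. If 0 < η ≤ σ·(q/ℓ)/(μn + 2L) and η ≤ (1/(2L))·(1 − 2qσ(n + 2L/μ)/(ℓ·((2n − q) + 4L/μ))), then, with S_ℓ = Σ_{t=0}^{ℓ−1} (1 − ημ)^t, one has (1 − 2Lη)·S_ℓ ≥ σq; equivalently, 2η(1 − 2Lη)·S_ℓ − (ηn/L)·σ·(2Lq/n) ≥ 0. -/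
/-- A lower bound for a finite geometric sum, obtained from Bernoulli's inequality. -/
theorem sub_sq_div_two_le_geom_sum {x : ℝ} (hx0 : 0 ≤ x) (hx2 : x ≤ 2) (l : ℕ) :
    (l : ℝ) - x * (l : ℝ) ^ 2 / 2 ≤ ∑ t ∈ Finset.range l, (1 - x) ^ t := by
  induction l with
  | zero => simp
  | succ k ih =>
    rw [Finset.sum_range_succ]
    have h : 1 + (k : ℝ) * (-x) ≤ (1 + -x) ^ k := one_add_mul_le_pow (by linarith) k
    rw [← sub_eq_add_neg] at h
    push_cast
    linarith

/-- Condition 2 in the proof of Theorem 1. -/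
theorem kSVRG_V2_condition2 (L μ : ℝ) (hL : 0 < L) (hμ : 0 < μ)
    (n l q : ℕ) (hn : 0 < n) (hl : 0 < l) (hq : 0 < q) (hqn : q ≤ n)
    (σ : ℝ) (hσ0 : 0 < σ) (hσ1 : σ ≤ 1)
    (η : ℝ) (hη0 : 0 < η) (hη1 : η ≤ σ * ((q : ℝ) / (l : ℝ)) / (μ * n + 2 * L))
    (hη2 : η ≤ (1 / (2 * L)) *
      (1 - 2 * (q : ℝ) * σ * ((n : ℝ) + 2 * L / μ) /
        ((l : ℝ) * ((2 * (n : ℝ) - (q : ℝ)) + 4 * L / μ))))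
    (S : ℝ) (hS : S = ∑ t ∈ Finset.range l, (1 - η * μ) ^ t) :
    (1 - 2 * L * η) * S ≥ σ * (q : ℝ) ∧
      2 * η * (1 - 2 * L * η) * S - (η * n / L) * σ * (2 * L * (q : ℝ) / (n : ℝ)) ≥ 0 := by
  have hq' : (0 : ℝ) < q := by exact_mod_cast hq
  have hn' : (0 : ℝ) < n := by exact_mod_cast hn
  have hl' : (1 : ℝ) ≤ l := by exact_mod_cast hl
  have hl0 : (0 : ℝ) < l := by linarith
  have hqn' : (q : ℝ) ≤ n := by exact_mod_cast hqn
  have hqμ : (q : ℝ) * μ ≤ n * μ := mul_le_mul_of_nonneg_right hqn' hμ.le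
  have hqμ0 : 0 < (q : ℝ) * μ := mul_pos hq' hμ
  have hD : 0 < μ * n + 2 * L := by positivity
  have hE : 0 < 2 * (μ * n + 2 * L) - q * μ := by linarith
  have hη1' : η * l * (μ * n + 2 * L) ≤ σ * q := by
    rw [le_div_iff₀ hD, mul_div_assoc', le_div_iff₀ hl0] at hη1
    linarith
  have hx : η * μ * l * (μ * n + 2 * L) ≤ q * μ := by
    have h1 := mul_le_mul_of_nonneg_right hη1' hμ.le
    have h2 := mul_le_mul_of_nonneg_right hσ1 hqμ0.le
    linarith
  have hxl : η * μ * l ≤ 1 := by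
    refine le_of_mul_le_mul_right ?_ hD
    linarith
  have hx1 : η * μ ≤ 1 := (le_mul_of_one_le_right (by positivity) hl').trans hxl
  have hgeom : (l : ℝ) * (2 * (μ * n + 2 * L) - q * μ) / (2 * (μ * n + 2 * L)) ≤ S := by
    rw [hS]
    refine le_trans ?_ (sub_sq_div_two_le_geom_sum (by positivity) (by linarith) l)
    rw [div_le_iff₀ (by positivity)]
    have h := mul_le_mul_of_nonneg_left hx hl0.le
    linarith
  have hfrac : 2 * (q : ℝ) * σ * ((n : ℝ) + 2 * L / μ) /
        ((l : ℝ) * ((2 * (n : ℝ) - (q : ℝ)) + 4 * L / μ)) =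
      2 * q * σ * (μ * n + 2 * L) / (l * (2 * (μ * n + 2 * L) - q * μ)) := by
    have h1 : (n : ℝ) + 2 * L / μ = (μ * n + 2 * L) / μ := by field_simp
    have h2 : (2 * (n : ℝ) - (q : ℝ)) + 4 * L / μ =
        (2 * (μ * n + 2 * L) - q * μ) / μ := by field_simp; ring
    rw [h1, h2]
    field_simp
  have ha : 2 * q * σ * (μ * n + 2 * L) / (l * (2 * (μ * n + 2 * L) - q * μ)) ≤
      1 - 2 * L * η := by
    rw [hfrac, one_div_mul_eq_div, le_div_iff₀ (by positivity)] at hη2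
    linarith
  have hmain : (1 - 2 * L * η) * S ≥ σ * (q : ℝ) := by
    have h := mul_le_mul ha hgeom (by positivity) (le_trans (by positivity) ha)
    refine le_trans (le_of_eq ?_) h
    have hE' := hE.ne'
    field_simp
  refine ⟨hmain, ?_⟩
  have heq : 2 * η * (1 - 2 * L * η) * S - (η * n / L) * σ * (2 * L * (q : ℝ) / (n : ℝ)) =
      2 * η * ((1 - 2 * L * η) * S - σ * q) := by field_simp
  rw [heq]
  exact mul_nonneg (by positivity) (sub_nonneg.mpr hmain)
end

section
/- (Condition 1 in the proof of Theorem 2.) Let L, μ > 0 be reals, let n, ℓ be positive integers with ℓ ≤ n, and let σ ∈ (0,1]. If 0 < η ≤ σ·(1 − (ℓ−1)/(2n))/(μn + 2L), then, with γ = ηn/L and S_ℓ = Σ_{t=0}^{ℓ−1} (1 − ημ)^t, one has γσ·(1 − 1/n)^ℓ + 2η²·S_ℓ ≤ γσ·(1 − ημ)^ℓ. -/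
theorem mul_one_sub_le_geom_sum (n l : ℕ) (hn : 0 < n) :
    (l : ℝ) * (1 - ((l : ℝ) - 1) / (2 * n)) ≤
      ∑ t ∈ Finset.range l, (1 - 1 / (n : ℝ)) ^ t := by
  have hn' : (1 : ℝ) ≤ n := by exact_mod_cast hn
  have h1 : 1 / (n : ℝ) ≤ 1 := by rw [div_le_one (by linarith)]; exact hn'
  induction l with
  | zero => simp
  | succ k ih =>
    rw [Finset.sum_range_succ]
    have hb := one_add_mul_le_pow (a := -(1 / (n : ℝ))) (by linarith) k
    rw [← sub_eq_add_neg] at hb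
    have he : ((k + 1 : ℕ) : ℝ) * (1 - (((k + 1 : ℕ) : ℝ) - 1) / (2 * n)) =
        (k : ℝ) * (1 - ((k : ℝ) - 1) / (2 * n)) + (1 + k * -(1 / (n : ℝ))) := by
      push_cast
      field_simp
      ring
    linarith

/-- Condition 1 in the proof of Theorem 2. -/
theorem kSVRG_V1_condition1 (L μ : ℝ) (hL : 0 < L) (hμ : 0 < μ)
    (n l : ℕ) (hn : 0 < n) (hl : 0 < l) (hln : l ≤ n)
    (σ : ℝ) (hσ0 : 0 < σ) (hσ1 : σ ≤ 1)
    (η : ℝ) (hη0 : 0 < η)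
    (hη : η ≤ σ * (1 - ((l : ℝ) - 1) / (2 * n)) / (μ * n + 2 * L))
    (γ : ℝ) (hγ : γ = η * n / L)
    (S : ℝ) (hS : S = ∑ t ∈ Finset.range l, (1 - η * μ) ^ t) :
    γ * σ * (1 - 1 / (n : ℝ)) ^ l + 2 * η ^ 2 * S ≤ γ * σ * (1 - η * μ) ^ l := by
  have hn' : (1 : ℝ) ≤ n := by exact_mod_cast hn
  have hl' : (1 : ℝ) ≤ l := by exact_mod_cast hl
  have hln' : (l : ℝ) ≤ n := by exact_mod_cast hln
  have hG := mul_one_sub_le_geom_sum n l hn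
  have hgb := mul_neg_geom_sum (1 - 1 / (n : ℝ)) l
  have hga := mul_neg_geom_sum (1 - η * μ) l
  rw [← hS] at hga
  set G := ∑ t ∈ Finset.range l, (1 - 1 / (n : ℝ)) ^ t
  set c := 1 - ((l : ℝ) - 1) / (2 * n) with hc
  have hc1 : c ≤ 1 := by
    have : 0 ≤ ((l : ℝ) - 1) / (2 * n) := div_nonneg (by linarith) (by linarith)
    linarith
  have hc0 : 0 ≤ c := by
    have : ((l : ℝ) - 1) / (2 * n) ≤ 1 := by
      rw [div_le_one (by linarith)]
      linarith
    linarith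
  rw [le_div_iff₀ (by positivity)] at hη
  have hx : 0 < η * μ := by positivity
  have hηL : 0 < η * L := by positivity
  have hx1 : η * μ ≤ 1 := by
    have h1 : σ * c ≤ 1 := mul_le_one₀ hσ1 hc0 hc1
    have h2 : η * μ ≤ η * μ * n := le_mul_of_one_le_right hx.le hn'
    linarith
  have hS0 : 0 ≤ S := by
    rw [hS]
    exact Finset.sum_nonneg fun t _ => pow_nonneg (by linarith) t
  have hSl : S ≤ l := by
    rw [hS]
    calc ∑ t ∈ Finset.range l, (1 - η * μ) ^ t ≤ ∑ _t ∈ Finset.range l, (1 : ℝ) :=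
          Finset.sum_le_sum fun t _ => pow_le_one₀ (by linarith) (by linarith)
      _ = l := by simp
  have hcG : c * S ≤ G := by
    have := mul_le_mul_of_nonneg_left hSl hc0
    linarith
  have key : 2 * (η * L) * S ≤ σ * (G - n * (η * μ) * S) := by
    have h1 : 2 * (η * L) ≤ σ * (c - n * (η * μ)) := by
      have : σ * (n * (η * μ)) ≤ n * (η * μ) := mul_le_of_le_one_left (by positivity) hσ1
      linarith
    have h2 := mul_le_mul_of_nonneg_right h1 hS0
    have h3 := mul_le_mul_of_nonneg_left hcG hσ0.le
    linarith
  have ha : (1 - η * μ) ^ l = 1 - η * μ * S := by linarith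
  have hb : (1 - 1 / (n : ℝ)) ^ l = 1 - G / n := by
    rw [div_eq_mul_one_div G]
    linarith
  have hdiff : γ * σ * (1 - η * μ * S) - (γ * σ * (1 - G / n) + 2 * η ^ 2 * S) =
      η / L * (σ * (G - n * (η * μ) * S) - 2 * (η * L) * S) := by
    rw [hγ]
    field_simp
    ring
  have hnonneg : 0 ≤ η / L * (σ * (G - n * (η * μ) * S) - 2 * (η * L) * S) :=
    mul_nonneg (by positivity) (sub_nonneg.mpr key)
  rw [ha, hb]
  linarith
end

section
/- (Condition 2 in the proof of Theorem 2.) Let L, μ > 0 be reals, let n, ℓ be positive integers with ℓ ≤ n, and let σ ∈ (0,1]. If 0 < η ≤ σ·(1 − (ℓ−1)/(2n))/(μn + 2L) and η ≤ (1/(2L))·(1 − 2σ(n + 2L/μ)/(2n − ℓ(1 − (ℓ−1)/(2n)) + 4L/μ)), then, with γ = ηn/L, S_ℓ = Σ_{t=0}^{ℓ−1} (1 − ημ)^t and Q_ℓ = Σ_{t=0}^{ℓ−1} (1 − 1/n)^t, one has 2η(1 − 2Lη)·S_ℓ − γσ·(2L·Q_ℓ/n) ≥ 0. -/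
/-- Bernoulli's inequality summed over a geometric progression. -/
theorem le_geom_sum_one_sub {a : ℝ} (ha : a ≤ 2) (l : ℕ) :
    (l : ℝ) - l * (l - 1) / 2 * a ≤ ∑ t ∈ Finset.range l, (1 - a) ^ t := by
  induction l with
  | zero => simp
  | succ k ih =>
    have h := one_add_mul_le_pow (a := -a) (by linarith) k
    rw [← sub_eq_add_neg] at h
    rw [Finset.sum_range_succ]
    push_cast
    linarith

/-- Condition 2 in the proof of Theorem 2. -/
theorem kSVRG_V1_condition2 (L μ : ℝ) (hL : 0 < L) (hμ : 0 < μ)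
    (n l : ℕ) (hn : 0 < n) (hl : 0 < l) (hln : l ≤ n)
    (σ : ℝ) (hσ0 : 0 < σ) (hσ1 : σ ≤ 1)
    (η : ℝ) (hη0 : 0 < η)
    (hη1 : η ≤ σ * (1 - ((l : ℝ) - 1) / (2 * n)) / (μ * n + 2 * L))
    (hη2 : η ≤ (1 / (2 * L)) *
      (1 - 2 * σ * ((n : ℝ) + 2 * L / μ) /
        (2 * (n : ℝ) - (l : ℝ) * (1 - ((l : ℝ) - 1) / (2 * n)) + 4 * L / μ)))
    (γ : ℝ) (hγ : γ = η * n / L)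
    (S : ℝ) (hS : S = ∑ t ∈ Finset.range l, (1 - η * μ) ^ t)
    (Q : ℝ) (hQ : Q = ∑ t ∈ Finset.range l, (1 - 1 / (n : ℝ)) ^ t) :
    2 * η * (1 - 2 * L * η) * S - γ * σ * (2 * L * Q / (n : ℝ)) ≥ 0 := by
  have hn' : (0 : ℝ) < n := by exact_mod_cast hn
  have hl1 : (1 : ℝ) ≤ l := by exact_mod_cast hl
  have hln' : (l : ℝ) ≤ n := by exact_mod_cast hln
  set c : ℝ := 1 - ((l : ℝ) - 1) / (2 * n) with hc
  have hc1 : c ≤ 1 := by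
    have : 0 ≤ ((l : ℝ) - 1) / (2 * n) := div_nonneg (by linarith) (by positivity)
    linarith
  have hc0 : 0 ≤ c := by
    have : ((l : ℝ) - 1) / (2 * n) ≤ 1 := by
      rw [div_le_one (by positivity)]
      linarith
    linarith
  have hM : 0 < μ * n + 2 * L := by positivity
  set x : ℝ := μ * c / (μ * n + 2 * L) with hx
  have hx0 : 0 ≤ x := by positivity
  have hηx : η * μ ≤ x := by
    have h : σ * c / (μ * n + 2 * L) ≤ c / (μ * n + 2 * L) := by
      gcongr
      nlinarith
    calc η * μ ≤ c / (μ * n + 2 * L) * μ := by gcongr; exact hη1.trans h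
      _ = x := by rw [hx]; ring
  have hlx : (l : ℝ) * x ≤ 1 := by
    rw [hx, ← mul_div_assoc, div_le_one hM]
    have h1 : (l : ℝ) * c ≤ n := by nlinarith
    nlinarith
  have hx1 : x ≤ 1 := by nlinarith
  have hK : 0 < 1 - l * x / 2 := by linarith
  have hfactor : σ / (1 - l * x / 2) ≤ 1 - 2 * L * η := by
    have hD : 2 * (n : ℝ) - (l : ℝ) * c + 4 * L / μ
        = 2 * (n + 2 * L / μ) * (1 - l * x / 2) := by
      rw [hx]
      field_simp
      ring
    have hE : 0 < (n : ℝ) + 2 * L / μ := by positivity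
    have hfrac : 2 * σ * ((n : ℝ) + 2 * L / μ) / (2 * (n : ℝ) - (l : ℝ) * c + 4 * L / μ)
        = σ / (1 - l * x / 2) := by
      rw [hD, div_eq_div_iff (by positivity) hK.ne']
      ring
    rw [hfrac, one_div_mul_eq_div, le_div_iff₀ (by positivity)] at hη2
    linarith
  have hQl : Q ≤ l := by
    have h1n : 1 / (n : ℝ) ≤ 1 := by
      rw [div_le_one hn']
      linarith
    have h0n : 0 < 1 / (n : ℝ) := by positivity
    rw [hQ]
    calc _ ≤ ∑ _t ∈ Finset.range l, (1 : ℝ) :=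
          Finset.sum_le_sum fun t _ => pow_le_one₀ (by linarith) (by linarith)
      _ = l := by simp
  have hSl : (l : ℝ) * (1 - l * x / 2) ≤ S := by
    have h := le_geom_sum_one_sub (a := η * μ) (by linarith) l
    rw [← hS] at h
    have h2 : ((l : ℝ) - 1) * (η * μ) ≤ l * x :=
      mul_le_mul (by linarith) hηx (by positivity) (by linarith)
    nlinarith
  have hS0 : 0 ≤ S := le_trans (by positivity) hSl
  have key : σ * Q ≤ (1 - 2 * L * η) * S :=
    calc σ * Q ≤ σ * l := by gcongr
      _ = σ / (1 - l * x / 2) * (l * (1 - l * x / 2)) := by rw [mul_left_comm, div_mul_cancel₀ _ hK.ne', mul_comm]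
      _ ≤ (1 - 2 * L * η) * S := by gcongr; exact le_trans (by positivity) hfactor
  have hγQ : γ * σ * (2 * L * Q / (n : ℝ)) = 2 * η * (σ * Q) := by
    rw [hγ]
    field_simp
  rw [hγQ, ge_iff_le, sub_nonneg, mul_assoc (2 * η)]
  gcongr
end

section
/- (Core estimate in the proof of Lemma 9.) Assume each f_i is L-smooth (not necessarily convex). For any x, x_0 ∈ E and any θ_1,…,θ_n ∈ E, with ᾱ = (1/n)·Σ_{j=1}^n ∇f_j(θ_j): (1/n)·Σ_{i=1}^n ‖∇f_i(x) − ∇f_i(θ_i) + ᾱ‖² ≤ 2‖∇f(x)‖² + 4L²·‖x − x_0‖² + (4L²/n)·Σ_{i=1}^n ‖x_0 − θ_i‖². -/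
/-- Translating a finite family by `a`, when its mean is `b - a`, increases the sum of squared
norms by at most `‖b‖ ^ 2` per member. -/
theorem sum_norm_add_sq_le_of_sum_eq {ι E : Type*} [Fintype ι] [NormedAddCommGroup E]
    [InnerProductSpace ℝ E] (d : ι → E) (a b : E)
    (h : ∑ i, d i = (Fintype.card ι : ℝ) • (b - a)) :
    ∑ i, ‖d i + a‖ ^ 2 ≤ ∑ i, ‖d i‖ ^ 2 + Fintype.card ι * ‖b‖ ^ 2 := by
  have hexp : ∑ i, ‖d i + a‖ ^ 2
      = ∑ i, ‖d i‖ ^ 2 + 2 * inner ℝ (∑ i, d i) a + Fintype.card ι * ‖a‖ ^ 2 := by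
    simp_rw [norm_add_sq_real, Finset.sum_add_distrib, sum_inner, Finset.mul_sum]
    simp
  rw [hexp, h, real_inner_smul_left, inner_sub_left, real_inner_self_eq_norm_sq]
  have hsq := norm_sub_sq_real b a
  have hmul := mul_nonneg (Nat.cast_nonneg (α := ℝ) (Fintype.card ι)) (sq_nonneg ‖b - a‖)
  rw [hsq] at hmul
  linarith

/-- The squared Lipschitz bound, split through an intermediate point `z`. -/
theorem norm_sq_le_of_norm_le_mul_norm_sub {E F : Type*} [SeminormedAddCommGroup E]
    [SeminormedAddCommGroup F] {L : ℝ} {v : F} {x y : E} (h : ‖v‖ ≤ L * ‖x - y‖) (z : E) :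
    ‖v‖ ^ 2 ≤ 2 * L ^ 2 * (‖x - z‖ ^ 2 + ‖z - y‖ ^ 2) := by
  have htri : ‖x - y‖ ^ 2 ≤ 2 * (‖x - z‖ ^ 2 + ‖z - y‖ ^ 2) :=
    (pow_le_pow_left₀ (norm_nonneg _) (norm_sub_le_norm_sub_add_norm_sub x z y) 2).trans add_sq_le
  calc ‖v‖ ^ 2 ≤ (L * ‖x - y‖) ^ 2 := pow_le_pow_left₀ (norm_nonneg _) h 2
    _ = L ^ 2 * ‖x - y‖ ^ 2 := mul_pow _ _ _
    _ ≤ L ^ 2 * (2 * (‖x - z‖ ^ 2 + ‖z - y‖ ^ 2)) :=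
        mul_le_mul_of_nonneg_left htri (sq_nonneg L)
    _ = 2 * L ^ 2 * (‖x - z‖ ^ 2 + ‖z - y‖ ^ 2) := by ring

/-- Core estimate in the proof of Lemma 9. -/
theorem kSVRG_variance_bound_anchor {E : Type*} [NormedAddCommGroup E]
    [InnerProductSpace ℝ E] [CompleteSpace E]
    (n : ℕ) (hn : 0 < n) (L : ℝ) (hL : 0 < L)
    (f : Fin n → E → ℝ) (g : Fin n → E → E)
    (hgrad : ∀ i x, HasGradientAt (f i) (g i x) x)
    (hsmooth : ∀ i x y, ‖g i x - g i y‖ ≤ L * ‖x - y‖)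
    (F : E → ℝ) (hF : ∀ x, F x = (1 / (n : ℝ)) * ∑ i, f i x)
    (G : E → E) (hG : ∀ x, G x = (1 / (n : ℝ)) • ∑ i, g i x)
    (θ : Fin n → E) (αbar : E) (hαbar : αbar = (1 / (n : ℝ)) • ∑ j, g j (θ j))
    (x x0 : E) :
    (1 / (n : ℝ)) * ∑ i, ‖g i x - g i (θ i) + αbar‖ ^ 2 ≤
      2 * ‖G x‖ ^ 2 + 4 * L ^ 2 * ‖x - x0‖ ^ 2
        + (4 * L ^ 2 / (n : ℝ)) * ∑ i, ‖x0 - θ i‖ ^ 2 := by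
  have hn0 : (0 : ℝ) < n := Nat.cast_pos.mpr hn
  have hmean : ∑ i, (g i x - g i (θ i)) = (Fintype.card (Fin n) : ℝ) • (G x - αbar) := by
    rw [hG, hαbar, ← smul_sub, smul_smul, Fintype.card_fin, mul_one_div_cancel hn0.ne', one_smul,
      Finset.sum_sub_distrib]
  have hvar := sum_norm_add_sq_le_of_sum_eq _ _ _ hmean
  have hlip : ∑ i, ‖g i x - g i (θ i)‖ ^ 2
      ≤ 2 * L ^ 2 * (n * ‖x - x0‖ ^ 2 + ∑ i, ‖x0 - θ i‖ ^ 2) := by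
    refine (Finset.sum_le_sum fun i _ =>
      norm_sq_le_of_norm_le_mul_norm_sub (hsmooth i x (θ i)) x0).trans_eq ?_
    rw [← Finset.mul_sum, Finset.sum_add_distrib]
    simp
  rw [Fintype.card_fin] at hvar
  have hG0 : 0 ≤ n * ‖G x‖ ^ 2 := by positivity
  have hD0 : 0 ≤ L ^ 2 * (n * ‖x - x0‖ ^ 2 + ∑ i, ‖x0 - θ i‖ ^ 2) := by positivity
  calc (1 / (n : ℝ)) * ∑ i, ‖g i x - g i (θ i) + αbar‖ ^ 2
      ≤ (1 / (n : ℝ)) * (2 * (n * ‖G x‖ ^ 2)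
          + 4 * (L ^ 2 * (n * ‖x - x0‖ ^ 2 + ∑ i, ‖x0 - θ i‖ ^ 2))) :=
        mul_le_mul_of_nonneg_left (by linarith) (by positivity)
    _ = _ := by
      field_simp
      ring
end

section
/- (Lemma 9, in tuple-average form.) With the non-convex inner-loop process defined below over tuples ω ∈ {1,…,n}^ℓ, for every 0 ≤ t ≤ ℓ−1: E_ω ‖v_t(ω)‖² ≤ 2·E_ω ‖∇f(x_t(ω))‖² + 4L²η²·t·Σ_{j=0}^{t−1} E_ω ‖v_j(ω)‖² + (4L²/n)·Σ_{i=1}^n ‖x_0 − θ_i‖². -/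
open Finset Function in
/-- Resampling one coordinate of a uniformly random tuple does not change an average. -/
theorem sum_sum_update {ι κ R : Type*} [Fintype ι] [DecidableEq ι] [Fintype κ] [CommSemiring R]
    (φ : (ι → κ) → R) (a : ι) :
    ∑ ω : ι → κ, ∑ k, φ (update ω a k) = Fintype.card κ * ∑ ω, φ ω := by
  classical
  have h : ∑ p : (ι → κ) × κ, φ (update p.1 a p.2) = ∑ p : (ι → κ) × κ, φ p.1 :=
    sum_nbij' (fun p => (update p.1 a p.2, p.1 a)) (fun p => (update p.1 a p.2, p.1 a))
      (by simp) (by simp) (by simp) (by simp) (by simp)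
  rw [Fintype.sum_prod_type, Fintype.sum_prod_type] at h
  simpa [mul_sum] using h

/-- Recentring a family of vectors at its mean does not increase the sum of squared norms;
a common shift `c` adds its own squared norm. -/
theorem sum_norm_sub_mean_add_sq_le {ι E : Type*} [Fintype ι] [NormedAddCommGroup E]
    [InnerProductSpace ℝ E] (ξ : ι → E) (m c : E)
    (hm : ∑ i, ξ i = (Fintype.card ι : ℝ) • m) :
    ∑ i, ‖ξ i - m + c‖ ^ 2 ≤ Fintype.card ι * ‖c‖ ^ 2 + ∑ i, ‖ξ i‖ ^ 2 := by
  have h1 : ∀ i, ‖ξ i - m + c‖ ^ 2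
      = ‖ξ i‖ ^ 2 + 2 * inner ℝ (ξ i) (c - m) + ‖c - m‖ ^ 2 := fun i => by
    rw [← norm_add_sq_real]
    congr 2
    abel
  simp_rw [h1, Finset.sum_add_distrib, ← Finset.mul_sum, ← sum_inner, hm, real_inner_smul_left,
    inner_sub_right, norm_sub_sq_real, real_inner_self_eq_norm_sq, real_inner_comm m c]
  simp only [Finset.sum_const, Finset.card_univ, nsmul_eq_mul]
  nlinarith [mul_nonneg (Nat.cast_nonneg (α := ℝ) (Fintype.card ι)) (sq_nonneg ‖m‖)]

/-- The displacement of `t` gradient-type steps of size `η`, bounded by Cauchy–Schwarz. -/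
theorem norm_sub_sq_le_of_steps {E : Type*} [NormedAddCommGroup E] [NormedSpace ℝ E]
    (η : ℝ) (x v : ℕ → E) (t : ℕ) (h : ∀ s < t, x (s + 1) = x s - η • v s) :
    ‖x t - x 0‖ ^ 2 ≤ η ^ 2 * (t * ∑ j ∈ Finset.range t, ‖v j‖ ^ 2) := by
  have hsum : x t - x 0 = -(η • ∑ j ∈ Finset.range t, v j) := by
    rw [← Finset.sum_range_sub, Finset.smul_sum, ← Finset.sum_neg_distrib]
    refine Finset.sum_congr rfl fun j hj => ?_
    rw [h j (Finset.mem_range.mp hj)]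
    abel
  rw [hsum, norm_neg, norm_smul, mul_pow, Real.norm_eq_abs, sq_abs]
  gcongr
  calc ‖∑ j ∈ Finset.range t, v j‖ ^ 2 ≤ (∑ j ∈ Finset.range t, ‖v j‖) ^ 2 := by
        gcongr
        exact norm_sum_le _ _
    _ ≤ t * ∑ j ∈ Finset.range t, ‖v j‖ ^ 2 := by
        simpa using sq_sum_le_card_mul_sum_sq (s := Finset.range t) (f := fun j => ‖v j‖)

/-- Second moment of the variance-reduced gradient estimate at a fixed point `x`. -/
theorem sum_norm_variance_reduced_sq_le {E : Type*} [NormedAddCommGroup E]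
    [InnerProductSpace ℝ E] {n : ℕ} (hn : 0 < n) (L : ℝ) (g : Fin n → E → E)
    (hsmooth : ∀ i x y, ‖g i x - g i y‖ ≤ L * ‖x - y‖) (θ : Fin n → E) (x x0 : E) :
    ∑ i, ‖g i x - g i (θ i) + (1 / (n : ℝ)) • ∑ j, g j (θ j)‖ ^ 2 ≤
      n * ‖(1 / (n : ℝ)) • ∑ i, g i x‖ ^ 2 + 2 * L ^ 2 * (n * ‖x - x0‖ ^ 2)
        + 2 * L ^ 2 * ∑ i, ‖x0 - θ i‖ ^ 2 := by
  have hn' : (n : ℝ) ≠ 0 := by positivity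
  have hpoint : ∀ i, ‖g i x - g i (θ i)‖ ^ 2
      ≤ 2 * L ^ 2 * ‖x - x0‖ ^ 2 + 2 * L ^ 2 * ‖x0 - θ i‖ ^ 2 := fun i =>
    calc ‖g i x - g i (θ i)‖ ^ 2 ≤ (L * ‖x - θ i‖) ^ 2 := by
          gcongr
          exact hsmooth _ _ _
      _ = L ^ 2 * ‖x - θ i‖ ^ 2 := by ring
      _ ≤ L ^ 2 * (‖x - x0‖ + ‖x0 - θ i‖) ^ 2 := by
          gcongr
          exact norm_sub_le_norm_sub_add_norm_sub _ _ _
      _ ≤ L ^ 2 * (2 * (‖x - x0‖ ^ 2 + ‖x0 - θ i‖ ^ 2)) := by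
          gcongr
          exact add_sq_le
      _ = _ := by ring
  have hvar := sum_norm_sub_mean_add_sq_le (fun i => g i x - g i (θ i))
    ((1 / (n : ℝ)) • ∑ i, g i x - (1 / (n : ℝ)) • ∑ j, g j (θ j))
    ((1 / (n : ℝ)) • ∑ i, g i x)
    (by simp [smul_sub, smul_smul, hn'])
  have hsum := Finset.sum_le_sum fun i (_ : i ∈ Finset.univ) => hpoint i
  rw [Finset.sum_add_distrib, ← Finset.mul_sum, ← Finset.mul_sum] at hsum
  simp only [Finset.sum_const, Finset.card_univ, nsmul_eq_mul, Fintype.card_fin] at hsum hvar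
  calc _ = ∑ i, ‖g i x - g i (θ i) - ((1 / (n : ℝ)) • ∑ i, g i x
          - (1 / (n : ℝ)) • ∑ j, g j (θ j)) + (1 / (n : ℝ)) • ∑ i, g i x‖ ^ 2 := by
        refine Finset.sum_congr rfl fun i _ => ?_
        congr 2
        abel
    _ ≤ _ := by linarith

/-- Lemma 9, in tuple-average form: bound on the expected squared norm of the
variance-reduced update direction in the non-convex inner loop. -/
theorem kSVRG_nonconvex_vt_bound {E : Type*} [NormedAddCommGroup E]
    [InnerProductSpace ℝ E] [CompleteSpace E]
    (n l : ℕ) (hn : 0 < n) (hl : 0 < l) (L : ℝ) (hL : 0 < L)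
    (f : Fin n → E → ℝ) (g : Fin n → E → E)
    (hgrad : ∀ i x, HasGradientAt (f i) (g i x) x)
    (hsmooth : ∀ i x y, ‖g i x - g i y‖ ≤ L * ‖x - y‖)
    (F : E → ℝ) (hF : ∀ x, F x = (1 / (n : ℝ)) * ∑ i, f i x)
    (G : E → E) (hG : ∀ x, G x = (1 / (n : ℝ)) • ∑ i, g i x)
    (θ : Fin n → E) (αbar : E) (hαbar : αbar = (1 / (n : ℝ)) • ∑ j, g j (θ j))
    (η : ℝ) (hη : 0 < η) (x0 : E)
    (X V : (Fin l → Fin n) → ℕ → E)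
    (hX0 : ∀ ω, X ω 0 = x0)
    (hV : ∀ ω (t : Fin l),
      V ω t.val = g (ω t) (X ω t.val) - g (ω t) (θ (ω t)) + αbar)
    (hXstep : ∀ ω (t : Fin l), X ω (t.val + 1) = X ω t.val - η • V ω t.val)
    (t : ℕ) (ht : t < l) :
    (1 / (n : ℝ) ^ l) * ∑ ω : Fin l → Fin n, ‖V ω t‖ ^ 2 ≤
      2 * ((1 / (n : ℝ) ^ l) * ∑ ω : Fin l → Fin n, ‖G (X ω t)‖ ^ 2)
        + 4 * L ^ 2 * η ^ 2 * (t : ℝ) *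
            ∑ j ∈ Finset.range t,
              ((1 / (n : ℝ) ^ l) * ∑ ω : Fin l → Fin n, ‖V ω j‖ ^ 2)
        + (4 * L ^ 2 / (n : ℝ)) * ∑ i, ‖x0 - θ i‖ ^ 2 := by
  have hn' : (0 : ℝ) < n := by positivity
  have hupd : ∀ ω i, ∀ s ≤ t, X (Function.update ω ⟨t, ht⟩ i) s = X ω s := by
    intro ω i s
    induction s with
    | zero => simp [hX0]
    | succ s ih =>
      intro hs
      have hne : (⟨s, by omega⟩ : Fin l) ≠ ⟨t, ht⟩ := by simp; omega
      have hx := ih (by omega)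
      have h1 := hXstep (Function.update ω ⟨t, ht⟩ i) ⟨s, by omega⟩
      have h2 := hV (Function.update ω ⟨t, ht⟩ i) ⟨s, by omega⟩
      rw [Function.update_of_ne hne] at h2
      simp only [hx] at h1 h2
      rw [h1, h2, ← hV ω ⟨s, by omega⟩]
      exact (hXstep ω ⟨s, by omega⟩).symm
  have hcond : ∀ ω, ∑ i, ‖V (Function.update ω ⟨t, ht⟩ i) t‖ ^ 2 ≤
      n * ‖G (X ω t)‖ ^ 2
        + 2 * L ^ 2 * (n * (η ^ 2 * (t * ∑ j ∈ Finset.range t, ‖V ω j‖ ^ 2)))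
        + 2 * L ^ 2 * ∑ i, ‖x0 - θ i‖ ^ 2 := by
    intro ω
    have hVt : ∀ i, V (Function.update ω ⟨t, ht⟩ i) t
        = g i (X ω t) - g i (θ i) + (1 / (n : ℝ)) • ∑ j, g j (θ j) := fun i => by
      simpa [hupd ω i t le_rfl, hαbar] using hV (Function.update ω ⟨t, ht⟩ i) ⟨t, ht⟩
    have hdisp := norm_sub_sq_le_of_steps η (X ω) (V ω) t
      fun s hs => hXstep ω ⟨s, by omega⟩
    rw [hX0] at hdisp
    simp_rw [hVt, hG]
    refine (sum_norm_variance_reduced_sq_le hn L g hsmooth θ (X ω t) x0).trans ?_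
    gcongr
  have hsum := Finset.sum_le_sum fun ω (_ : ω ∈ Finset.univ) => hcond ω
  rw [sum_sum_update (fun ω => ‖V ω t‖ ^ 2)] at hsum
  simp only [Finset.sum_add_distrib, ← Finset.mul_sum, Finset.sum_const, Finset.card_univ,
    nsmul_eq_mul, Fintype.card_fin, Fintype.card_pi, Finset.prod_const, Nat.cast_pow] at hsum
  rw [Finset.sum_comm (s := Finset.univ) (t := Finset.range t)] at hsum
  rw [← Finset.mul_sum]
  set A := ∑ ω, ‖V ω t‖ ^ 2
  set B := ∑ ω, ‖G (X ω t)‖ ^ 2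
  set C := ∑ j ∈ Finset.range t, ∑ ω, ‖V ω j‖ ^ 2
  set D := ∑ i, ‖x0 - θ i‖ ^ 2
  have hB : 0 ≤ B := by positivity
  have hC : 0 ≤ C := by positivity
  have hD : 0 ≤ D := by positivity
  have hA : A ≤ B + 2 * L ^ 2 * (η ^ 2 * (t * C)) + (n : ℝ) ^ l * (2 * L ^ 2 / n * D) := by
    refine le_of_mul_le_mul_left (hsum.trans_eq ?_) hn'
    field_simp
  calc 1 / (n : ℝ) ^ l * A
      ≤ 1 / (n : ℝ) ^ l * (2 * B + 4 * L ^ 2 * η ^ 2 * t * C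
          + (n : ℝ) ^ l * (4 * L ^ 2 / n * D)) := by
        gcongr
        have h1 : 0 ≤ L ^ 2 * (η ^ 2 * (t * C)) := by positivity
        have h2 : 0 ≤ (n : ℝ) ^ l * (2 * L ^ 2 / n * D) := by positivity
        have h3 : (n : ℝ) ^ l * (4 * L ^ 2 / n * D)
          = 2 * ((n : ℝ) ^ l * (2 * L ^ 2 / n * D)) := by ring
        linarith
    _ = _ := by
        field_simp
end

section
/- (Lemma 5, deterministic form.) Let v_0,…,v_{ℓ−1} ∈ E, η ∈ ℝ, and define x_{t+1} = x_t − η·v_t for t = 0,…,ℓ−1 starting from any x_0 ∈ E. Let x̃ = (1/ℓ)·Σ_{t=0}^{ℓ−1} x_t. Then ‖x_ℓ − x̃‖² ≤ (η²·(ℓ+1)(2ℓ+1)/(6ℓ))·Σ_{t=0}^{ℓ−1} ‖v_t‖², and in particular ‖x_ℓ − x̃‖² ≤ η²·ℓ·Σ_{t=0}^{ℓ−1} ‖v_t‖². -/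
theorem smul_sub_sum_range_of_step {E : Type*} [AddCommGroup E] [Module ℝ E]
    (l : ℕ) (η : ℝ) (v X : ℕ → E) (hstep : ∀ t < l, X (t + 1) = X t - η • v t) :
    (l : ℝ) • X l - ∑ t ∈ Finset.range l, X t =
      -(η • ∑ t ∈ Finset.range l, ((t : ℝ) + 1) • v t) := by
  induction l with
  | zero => simp
  | succ n ih =>
    have h := ih fun t ht => hstep t (ht.trans n.lt_succ_self)
    rw [sub_eq_iff_eq_add] at h
    rw [Finset.sum_range_succ, Finset.sum_range_succ, hstep n n.lt_succ_self]
    push_cast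
    rw [add_smul, one_smul, smul_sub, h]
    module

theorem sum_range_add_one_sq (l : ℕ) :
    ∑ t ∈ Finset.range l, ((t : ℝ) + 1) ^ 2 = (l : ℝ) * (l + 1) * (2 * l + 1) / 6 := by
  induction l with
  | zero => simp
  | succ n ih =>
    rw [Finset.sum_range_succ, ih]
    push_cast
    ring

theorem norm_sum_smul_sq_le {ι E : Type*} [SeminormedAddCommGroup E] [NormedSpace ℝ E]
    (s : Finset ι) (a : ι → ℝ) (v : ι → E) :
    ‖∑ i ∈ s, a i • v i‖ ^ 2 ≤ (∑ i ∈ s, a i ^ 2) * ∑ i ∈ s, ‖v i‖ ^ 2 := by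
  calc ‖∑ i ∈ s, a i • v i‖ ^ 2 ≤ (∑ i ∈ s, |a i| * ‖v i‖) ^ 2 := by
        gcongr
        exact (norm_sum_le _ _).trans_eq (by simp [norm_smul])
    _ ≤ (∑ i ∈ s, |a i| ^ 2) * ∑ i ∈ s, ‖v i‖ ^ 2 :=
        Finset.sum_mul_sq_le_sq_mul_sq _ _ _
    _ = _ := by simp only [sq_abs]


/-- Lemma 5, deterministic form: distance between the final iterate and the
average of the iterates. -/
theorem kSVRG_average_distance {E : Type*} [NormedAddCommGroup E]
    [InnerProductSpace ℝ E]
    (l : ℕ) (hl : 0 < l) (η : ℝ) (v : ℕ → E) (X : ℕ → E)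
    (hstep : ∀ t < l, X (t + 1) = X t - η • v t)
    (xt : E) (hxt : xt = (1 / (l : ℝ)) • ∑ t ∈ Finset.range l, X t) :
    ‖X l - xt‖ ^ 2 ≤
        (η ^ 2 * ((l : ℝ) + 1) * (2 * (l : ℝ) + 1) / (6 * (l : ℝ))) *
          ∑ t ∈ Finset.range l, ‖v t‖ ^ 2 ∧
      ‖X l - xt‖ ^ 2 ≤ η ^ 2 * (l : ℝ) * ∑ t ∈ Finset.range l, ‖v t‖ ^ 2 := by
  have hl1 : (1 : ℝ) ≤ l := by exact_mod_cast hl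
  have hl0 : (l : ℝ) ≠ 0 := by positivity
  have hdiff : X l - xt =
      (-(η / l)) • ∑ t ∈ Finset.range l, ((t : ℝ) + 1) • v t := by
    have h := congrArg ((1 / (l : ℝ)) • ·) (smul_sub_sum_range_of_step l η v X hstep)
    simp only [smul_sub, smul_smul, one_div_mul_cancel hl0, one_smul, ← hxt] at h
    rw [h]
    module
  have hfirst : ‖X l - xt‖ ^ 2 ≤
      (η ^ 2 * ((l : ℝ) + 1) * (2 * (l : ℝ) + 1) / (6 * (l : ℝ))) *
        ∑ t ∈ Finset.range l, ‖v t‖ ^ 2 := by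
    have h := norm_sum_smul_sq_le (Finset.range l) (fun t => (t : ℝ) + 1) v
    rw [sum_range_add_one_sq] at h
    rw [hdiff, norm_smul, mul_pow, Real.norm_eq_abs, sq_abs, neg_sq]
    refine (mul_le_mul_of_nonneg_left h (sq_nonneg _)).trans_eq ?_
    field_simp
  refine ⟨hfirst, hfirst.trans (mul_le_mul_of_nonneg_right ?_ (by positivity))⟩
  rw [div_le_iff₀ (by positivity)]
  have h : ((l : ℝ) + 1) * (2 * l + 1) ≤ 6 * l ^ 2 := by nlinarith
  nlinarith [mul_le_mul_of_nonneg_left h (sq_nonneg η)]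
end

section
/- (Lemma 7, in tuple-average form.) With the non-convex inner-loop process defined below over tuples ω ∈ {1,…,n}^ℓ: (1 − 2L²η²ℓ²)·E_ω Σ_{t=0}^{ℓ−1} ‖v_t(ω)‖² ≤ 2·E_ω Σ_{t=0}^{ℓ−1} ‖∇f(x_t(ω))‖² + 4L²·ℓ·(1/n)·Σ_{i=1}^n ‖x_0 − θ_i‖². -/
/-- Resampling one coordinate leaves a sum over all tuples unchanged, up to the number of values. -/
theorem sum_sum_update_s13 {ι κ M : Type*} [Fintype ι] [DecidableEq ι] [Fintype κ] [AddCommMonoid M]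
    (t : ι) (h : (ι → κ) → M) :
    ∑ ω : ι → κ, ∑ i : κ, h (Function.update ω t i) = Fintype.card κ • ∑ ω, h ω := by
  have hinv : Function.Involutive
      fun p : (ι → κ) × κ => (Function.update p.1 t p.2, p.1 t) := by
    rintro ⟨ω, i⟩
    simp
  have hswap := Equiv.sum_comp hinv.toPerm fun p : (ι → κ) × κ => h p.1
  simp only [Function.Involutive.coe_toPerm, Fintype.sum_prod_type] at hswap
  rw [hswap]
  simp [Finset.sum_nsmul]

/-- The variance of a finite family is at most its second moment. -/
theorem sum_norm_add_sq_le {ι E : Type*} [Fintype ι] [NormedAddCommGroup E]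
    [InnerProductSpace ℝ E] (b : ι → E) (m c : E)
    (hm : (Fintype.card ι : ℝ) • m = ∑ i, b i) :
    ∑ i, ‖b i + c‖ ^ 2 ≤ ∑ i, ‖b i‖ ^ 2 + Fintype.card ι * ‖m + c‖ ^ 2 := by
  have hinner : (Fintype.card ι : ℝ) * inner ℝ m c = ∑ i, inner ℝ (b i) c := by
    rw [← real_inner_smul_left, hm, sum_inner]
  have hexp : ∑ i, ‖b i + c‖ ^ 2 =
      ∑ i, ‖b i‖ ^ 2 + 2 * ∑ i, inner ℝ (b i) c + Fintype.card ι * ‖c‖ ^ 2 := by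
    simp only [norm_add_sq_real, Finset.sum_add_distrib, ← Finset.mul_sum, Finset.sum_const,
      Finset.card_univ, nsmul_eq_mul]
  rw [hexp, ← hinner, norm_add_sq_real]
  have : 0 ≤ (Fintype.card ι : ℝ) * ‖m‖ ^ 2 := by positivity
  linarith

theorem norm_sub_sq_le_two_mul {E : Type*} [SeminormedAddCommGroup E] (x y z : E) :
    ‖x - z‖ ^ 2 ≤ 2 * ‖x - y‖ ^ 2 + 2 * ‖y - z‖ ^ 2 := by
  have h := norm_sub_le_norm_sub_add_norm_sub x y z
  nlinarith [norm_nonneg (x - z), sq_nonneg (‖x - y‖ - ‖y - z‖)]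

/-- The squared displacement after `t` steps of a constant-stepsize recursion. -/
theorem norm_sub_sq_le_of_step {E : Type*} [SeminormedAddCommGroup E] [NormedSpace ℝ E]
    (x v : ℕ → E) (η : ℝ) (t : ℕ) (hstep : ∀ s < t, x (s + 1) = x s - η • v s) :
    ‖x t - x 0‖ ^ 2 ≤ η ^ 2 * (t * ∑ s ∈ Finset.range t, ‖v s‖ ^ 2) := by
  have hsum : x t - x 0 = -(η • ∑ s ∈ Finset.range t, v s) := by
    rw [← Finset.sum_range_sub, Finset.smul_sum, ← Finset.sum_neg_distrib]
    refine Finset.sum_congr rfl fun s hs => ?_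
    rw [hstep s (Finset.mem_range.mp hs)]
    abel
  rw [hsum, norm_neg, norm_smul, mul_pow, Real.norm_eq_abs, sq_abs]
  gcongr
  calc ‖∑ s ∈ Finset.range t, v s‖ ^ 2 ≤ (∑ s ∈ Finset.range t, ‖v s‖) ^ 2 := by
        gcongr
        exact norm_sum_le _ _
    _ ≤ t * ∑ s ∈ Finset.range t, ‖v s‖ ^ 2 := by
        simpa using sq_sum_le_card_mul_sum_sq (s := Finset.range t) (f := fun s => ‖v s‖)

/-- Second-moment bound for the variance-reduced gradient estimator at a fixed point. -/
theorem sum_norm_svrg_sq_le {ι E : Type*} [Fintype ι] [Nonempty ι] [NormedAddCommGroup E]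
    [InnerProductSpace ℝ E] (g : ι → E → E) (L : ℝ)
    (hsmooth : ∀ i x y, ‖g i x - g i y‖ ≤ L * ‖x - y‖) (θ : ι → E) (x x0 : E) :
    ∑ i, ‖g i x - g i (θ i) + (1 / (Fintype.card ι : ℝ)) • ∑ j, g j (θ j)‖ ^ 2 ≤
      Fintype.card ι * ‖(1 / (Fintype.card ι : ℝ)) • ∑ j, g j x‖ ^ 2
        + 2 * L ^ 2 * (Fintype.card ι * ‖x - x0‖ ^ 2) + 2 * L ^ 2 * ∑ i, ‖x0 - θ i‖ ^ 2 := by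
  have hcard : (Fintype.card ι : ℝ) ≠ 0 := Nat.cast_ne_zero.mpr Fintype.card_ne_zero
  have hvar := sum_norm_add_sq_le (fun i => g i x - g i (θ i))
    ((1 / (Fintype.card ι : ℝ)) • ∑ j, g j x - (1 / (Fintype.card ι : ℝ)) • ∑ j, g j (θ j))
    ((1 / (Fintype.card ι : ℝ)) • ∑ j, g j (θ j))
    (by simp only [smul_sub, smul_smul, mul_one_div_cancel hcard, one_smul,
      Finset.sum_sub_distrib])
  rw [sub_add_cancel] at hvar
  have hlip : ∑ i, ‖g i x - g i (θ i)‖ ^ 2 ≤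
      ∑ i, (2 * L ^ 2 * ‖x - x0‖ ^ 2 + 2 * L ^ 2 * ‖x0 - θ i‖ ^ 2) := by
    refine Finset.sum_le_sum fun i _ => ?_
    calc ‖g i x - g i (θ i)‖ ^ 2 ≤ (L * ‖x - θ i‖) ^ 2 := by
          gcongr
          exact hsmooth i x (θ i)
      _ = L ^ 2 * ‖x - θ i‖ ^ 2 := mul_pow _ _ _
      _ ≤ L ^ 2 * (2 * ‖x - x0‖ ^ 2 + 2 * ‖x0 - θ i‖ ^ 2) := by
          gcongr
          exact norm_sub_sq_le_two_mul x x0 (θ i)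
      _ = _ := by ring
  rw [Finset.sum_add_distrib, ← Finset.mul_sum, Finset.sum_const, Finset.card_univ,
    nsmul_eq_mul, ← Finset.mul_sum] at hlip
  linarith


/-- Lemma 7, in tuple-average form: summed variance bound over one inner loop of the
non-convex process. -/
theorem kSVRG_nonconvex_V_frobenius_bound {E : Type*} [NormedAddCommGroup E]
    [InnerProductSpace ℝ E] [CompleteSpace E]
    (n l : ℕ) (hn : 0 < n) (hl : 0 < l) (L : ℝ) (hL : 0 < L)
    (f : Fin n → E → ℝ) (g : Fin n → E → E)
    (hgrad : ∀ i x, HasGradientAt (f i) (g i x) x)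
    (hsmooth : ∀ i x y, ‖g i x - g i y‖ ≤ L * ‖x - y‖)
    (F : E → ℝ) (hF : ∀ x, F x = (1 / (n : ℝ)) * ∑ i, f i x)
    (G : E → E) (hG : ∀ x, G x = (1 / (n : ℝ)) • ∑ i, g i x)
    (θ : Fin n → E) (αbar : E) (hαbar : αbar = (1 / (n : ℝ)) • ∑ j, g j (θ j))
    (η : ℝ) (hη : 0 < η) (x0 : E)
    (X V : (Fin l → Fin n) → ℕ → E)
    (hX0 : ∀ ω, X ω 0 = x0)
    (hV : ∀ ω (t : Fin l),
      V ω t.val = g (ω t) (X ω t.val) - g (ω t) (θ (ω t)) + αbar)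
    (hXstep : ∀ ω (t : Fin l), X ω (t.val + 1) = X ω t.val - η • V ω t.val) :
    (1 - 2 * L ^ 2 * η ^ 2 * (l : ℝ) ^ 2) *
        ((1 / (n : ℝ) ^ l) * ∑ ω : Fin l → Fin n, ∑ t ∈ Finset.range l, ‖V ω t‖ ^ 2) ≤
      2 * ((1 / (n : ℝ) ^ l) *
            ∑ ω : Fin l → Fin n, ∑ t ∈ Finset.range l, ‖G (X ω t)‖ ^ 2)
        + 4 * L ^ 2 * (l : ℝ) * ((1 / (n : ℝ)) * ∑ i, ‖x0 - θ i‖ ^ 2) := by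
  have : Nonempty (Fin n) := ⟨⟨0, hn⟩⟩
  have hlocal : ∀ t ≤ l, ∀ ω ω' : Fin l → Fin n, (∀ s : Fin l, s.val < t → ω s = ω' s) →
      X ω t = X ω' t := by
    intro t
    induction t with
    | zero => intro _ ω ω' _; rw [hX0, hX0]
    | succ t ih =>
      intro ht ω ω' hω
      have hx := ih (by omega) ω ω' fun s hs => hω s (by omega)
      have hi := hω ⟨t, ht⟩ (Nat.lt_succ_self t)
      rw [hXstep ω ⟨t, ht⟩, hXstep ω' ⟨t, ht⟩, hV ω ⟨t, ht⟩, hV ω' ⟨t, ht⟩, hi]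
      simp only [hx]
  set D : ℝ := ∑ i, ‖x0 - θ i‖ ^ 2
  have hstep : ∀ t ∈ Finset.range l, (n : ℝ) * ∑ ω, ‖V ω t‖ ^ 2 ≤
      ∑ ω : Fin l → Fin n, (n * ‖G (X ω t)‖ ^ 2
        + 2 * L ^ 2 * (n * (η ^ 2 * (l * ∑ s ∈ Finset.range l, ‖V ω s‖ ^ 2)))
        + 2 * L ^ 2 * D) := by
    intro t ht
    have htl : t < l := Finset.mem_range.mp ht
    have hresample := sum_sum_update_s13 (⟨t, htl⟩ : Fin l)
      fun ω : Fin l → Fin n => ‖V ω t‖ ^ 2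
    rw [Fintype.card_fin, nsmul_eq_mul] at hresample
    rw [← hresample]
    refine Finset.sum_le_sum fun ω _ => ?_
    have hVupdate : ∀ i, V (Function.update ω ⟨t, htl⟩ i) t =
        g i (X ω t) - g i (θ i) + αbar := by
      intro i
      have hx : X (Function.update ω ⟨t, htl⟩ i) t = X ω t :=
        hlocal t htl.le _ _ fun s hs =>
          Function.update_of_ne (fun h => by simp [h] at hs) _ _
      rw [hV _ ⟨t, htl⟩]
      simp only [Function.update_self, hx]
    simp only [hVupdate]
    have hmoment := sum_norm_svrg_sq_le g L hsmooth θ (X ω t) x0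
    rw [Fintype.card_fin, ← hαbar, ← hG] at hmoment
    refine hmoment.trans ?_
    have hdisp := norm_sub_sq_le_of_step (X ω) (V ω) η t
      fun s hs => hXstep ω ⟨s, hs.trans htl⟩
    rw [hX0] at hdisp
    gcongr
    refine hdisp.trans ?_
    gcongr
  have hsum := Finset.sum_le_sum hstep
  rw [← Finset.mul_sum, Finset.sum_comm, Finset.sum_comm (s := Finset.range l)] at hsum
  simp only [Finset.sum_add_distrib, ← Finset.mul_sum, Finset.sum_const, Finset.card_univ,
    Finset.card_range, Fintype.card_pi, Fintype.card_fin, Finset.prod_const, nsmul_eq_mul,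
    Nat.cast_pow] at hsum
  have hn' : (0 : ℝ) < n := Nat.cast_pos.mpr hn
  set S : ℝ := ∑ ω : Fin l → Fin n, ∑ t ∈ Finset.range l, ‖V ω t‖ ^ 2
  set T : ℝ := ∑ ω : Fin l → Fin n, ∑ t ∈ Finset.range l, ‖G (X ω t)‖ ^ 2
  have hT : 0 ≤ T := by positivity
  have hD0 : 0 ≤ D := by positivity
  have hfactor : 0 ≤ 1 / (n : ℝ) ^ l * (1 / n) := by positivity
  have hscaled := mul_le_mul_of_nonneg_left hsum hfactor
  have hTavg : 0 ≤ 1 / (n : ℝ) ^ l * T := by positivity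
  have hDavg : 0 ≤ 2 * L ^ 2 * l * (1 / (n : ℝ) * D) := by positivity
  have hleft : 1 / (n : ℝ) ^ l * (1 / n) * (n * S) = 1 / (n : ℝ) ^ l * S := by field_simp
  have hright : 1 / (n : ℝ) ^ l * (1 / n) * (n * T + 2 * L ^ 2 * (n * (η ^ 2 * (l * (l * S))))
      + 2 * L ^ 2 * (l * (n ^ l * D))) =
      1 / (n : ℝ) ^ l * T + 2 * L ^ 2 * η ^ 2 * l ^ 2 * (1 / (n : ℝ) ^ l * S)
        + 2 * L ^ 2 * l * (1 / (n : ℝ) * D) := by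
    field_simp
  rw [hleft, hright] at hscaled
  linarith
end

section
/- (Theorem 3, first part: non-convex convergence of k-SVRG-V2.) Let each f_i be L-smooth and let f be bounded below by f*. Let ℓ ≤ n, η > 0 with 2L²η²ℓ² < 1, b₁ = 1/(1 − 2L²η²ℓ²), γ > 0, and M a positive integer. Define c^M = 0 and, for m = M−1,…,0, c^m = c^{m+1}·(1 − ℓ/n + γηℓ + 4b₁η²L²ℓ²) + 2b₁η²L³ℓ, and Γ^m = η − c^{m+1}·η/γ − b₁η²L − 2b₁c^{m+1}η²ℓ; assume Γ^m > 0 for all m and set Γ = min_{0≤m≤M−1} Γ^m. Run M outer loops of the following process, starting from x^0_0 ∈ E with θ^0_i = x^0_0 for all i: in outer loop m, draw a fresh uniform tuple ω^m ∈ {1,…,n}^ℓ and iterate x^m_{t+1} = x^m_t − η·(∇f_{i_t}(x^m_t) − ∇f_{i_t}(θ^m_{i_t}) + (1/n)·Σ_j ∇f_j(θ^m_j)); set x̃^{m+1} = (1/ℓ)·Σ_{t=0}^{ℓ−1} x^m_t, x^{m+1}_0 = x^m_ℓ, draw a fresh uniform ℓ-element subset Φ^m ⊆ {1,…,n} (independent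 of all tuples), and set θ^{m+1}_i = x̃^{m+1} for i ∈ Φ^m and θ^{m+1}_i = θ^m_i otherwise. Then, with E denoting the average over all M independent uniform tuples and M independent uniform subsets: Σ_{m=0}^{M−1} E[ Σ_{t=0}^{ℓ−1} ‖∇f(x^m_t)‖² ] ≤ (f(x^0_0) − f*)/Γ. -/
open Finset in
/-- A function that depends on a coordinate of a finite sample space only through its second
argument may have that coordinate resampled uniformly. -/
theorem sum_resample {Ω α : Type*} [Fintype Ω] [Fintype α] (get : Ω → α) (set : Ω → α → Ω)
    (get_set : ∀ σ a, get (set σ a) = a) (set_get : ∀ σ, set σ (get σ) = σ)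
    (set_set : ∀ σ a b, set (set σ a) b = set σ b)
    (Ψ : Ω → α → ℝ) (hΨ : ∀ σ a b, Ψ (set σ a) b = Ψ σ b) :
    (Fintype.card α : ℝ) * ∑ σ, Ψ σ (get σ) = ∑ σ, ∑ a, Ψ σ a := by
  have hinv : Function.Involutive fun p : Ω × α ↦ (set p.1 p.2, get p.1) := by
    rintro ⟨σ, a⟩
    simp [get_set, set_set, set_get]
  calc (Fintype.card α : ℝ) * ∑ σ, Ψ σ (get σ)
      = ∑ p : Ω × α, Ψ p.1 (get p.1) := by
        rw [Fintype.sum_prod_type, mul_sum]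
        simp
    _ = ∑ p : Ω × α, Ψ (set p.1 p.2) (get (set p.1 p.2)) :=
        (Equiv.sum_comp hinv.toPerm fun p : Ω × α ↦ Ψ p.1 (get p.1)).symm
    _ = ∑ σ, ∑ a, Ψ σ a := by
        simp only [get_set, hΨ]
        exact Fintype.sum_prod_type' Ψ

open Finset in
theorem card_mul_card_subtype_filter_mem {n l : ℕ} (hl : 0 < l) (i : Fin n) :
    n * #{s : {s : Finset (Fin n) // s.card = l} | i ∈ s.val} = l * n.choose l := by
  have hcard : #{s : {s : Finset (Fin n) // s.card = l} | i ∈ s.val}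
      = (n - 1).choose (l - 1) := by
    have h := card_filter_powersetCard_subset {i} (univ : Finset (Fin n)) l (subset_univ _)
    simp only [card_singleton, card_univ, Fintype.card_fin, singleton_subset_iff] at h
    rw [← h (by omega)]
    refine card_bij (fun s _ ↦ s.val) ?_ ?_ ?_
    · rintro ⟨s, hs⟩ h
      simpa [hs] using h
    · rintro ⟨s, hs⟩ _ ⟨t, ht⟩ _ h
      simpa using h
    · intro s hs
      rw [mem_filter, mem_powersetCard] at hs
      exact ⟨⟨s, hs.1.2⟩, by simpa using hs.2, rfl⟩
  obtain ⟨k, rfl⟩ := Nat.exists_eq_succ_of_ne_zero hl.ne'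
  obtain ⟨p, rfl⟩ := Nat.exists_eq_succ_of_ne_zero i.pos.ne'
  rw [hcard]
  simpa [mul_comm] using Nat.add_one_mul_choose_eq p k

open Finset in
theorem sum_subtype_ite_mem {n l : ℕ} (hn : 0 < n) (hl : 0 < l) (a : ℝ) (b : Fin n → ℝ) :
    ∑ s : {s : Finset (Fin n) // s.card = l}, ∑ i, (if i ∈ s.val then a else b i) =
      (n.choose l : ℝ) * (l * a + (1 - (l : ℝ) / n) * ∑ i, b i) := by
  have hn' : (n : ℝ) ≠ 0 := by positivity
  have hmem (i : Fin n) : (#{s : {s : Finset (Fin n) // s.card = l} | i ∈ s.val} : ℝ)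
      = l / n * n.choose l := by
    have := card_mul_card_subtype_filter_mem hl i
    rw [div_mul_eq_mul_div, eq_div_iff hn', mul_comm]
    exact_mod_cast this
  have key (i : Fin n) : ∑ s : {s : Finset (Fin n) // s.card = l},
      (if i ∈ s.val then a else b i)
        = (n.choose l : ℝ) * (l / n * a + (1 - (l : ℝ) / n) * b i) := by
    have hsplit (s : {s : Finset (Fin n) // s.card = l}) :
        (if i ∈ s.val then a else b i) = b i + (if i ∈ s.val then 1 else 0) * (a - b i) := by
      split_ifs <;> ring
    simp_rw [hsplit]
    rw [sum_add_distrib, ← sum_mul, sum_boole, hmem]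
    simp
    ring
  rw [sum_comm]
  simp_rw [key]
  rw [← mul_sum, sum_add_distrib, sum_const, ← mul_sum, card_univ, Fintype.card_fin, nsmul_eq_mul,
    ← mul_assoc, mul_div_cancel₀ _ hn']

/-- The descent lemma for functions with Lipschitz gradient. -/
theorem le_add_inner_add_sq_of_lipschitz_gradient {E : Type*} [NormedAddCommGroup E]
    [InnerProductSpace ℝ E] [CompleteSpace E] {F : E → ℝ} {G : E → E} {L : ℝ}
    (hF : ∀ x, HasGradientAt F (G x) x) (hG : ∀ x y, ‖G x - G y‖ ≤ L * ‖x - y‖) (x d : E) :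
    F (x + d) ≤ F x + inner ℝ (G x) d + L / 2 * ‖d‖ ^ 2 := by
  have hderiv (t : ℝ) : HasDerivAt
      (fun t : ℝ ↦ F (x + t • d) - t * inner ℝ (G x) d - L / 2 * ‖d‖ ^ 2 * t ^ 2)
      (inner ℝ (G (x + t • d)) d - inner ℝ (G x) d - L / 2 * ‖d‖ ^ 2 * (2 * t)) t := by
    have hline : HasDerivAt (fun t : ℝ ↦ x + t • d) d t := by
      simpa using ((hasDerivAt_id t).smul_const d).const_add x
    have h1 : HasDerivAt (fun t : ℝ ↦ F (x + t • d)) (inner ℝ (G (x + t • d)) d) t := by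
      simpa [Function.comp_def] using (hF (x + t • d)).hasFDerivAt.comp_hasDerivAt t hline
    have h2 : HasDerivAt (fun t : ℝ ↦ t * inner ℝ (G x) d) (inner ℝ (G x) d) t := by
      simpa using (hasDerivAt_id t).mul_const (inner ℝ (G x) d)
    have h3 : HasDerivAt (fun t : ℝ ↦ L / 2 * ‖d‖ ^ 2 * t ^ 2) (L / 2 * ‖d‖ ^ 2 * (2 * t)) t := by
      simpa using (hasDerivAt_pow 2 t).const_mul (L / 2 * ‖d‖ ^ 2)
    exact (h1.sub h2).sub h3
  have hanti := antitoneOn_of_deriv_nonpos (convex_Icc (0 : ℝ) 1)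
    (fun t _ ↦ (hderiv t).continuousAt.continuousWithinAt)
    (fun t _ ↦ (hderiv t).differentiableAt.differentiableWithinAt)
    (fun t ht ↦ by
      rw [interior_Icc] at ht
      rw [(hderiv t).deriv, ← inner_sub_left]
      have h1 : inner ℝ (G (x + t • d) - G x) d ≤ ‖G (x + t • d) - G x‖ * ‖d‖ :=
        real_inner_le_norm _ _
      have h2 : ‖G (x + t • d) - G x‖ ≤ L * (t * ‖d‖) := by
        simpa [norm_smul, abs_of_pos ht.1] using hG (x + t • d) x
      nlinarith [mul_le_mul_of_nonneg_right h2 (norm_nonneg d)])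
  have h := hanti (Set.left_mem_Icc.mpr zero_le_one) (Set.right_mem_Icc.mpr zero_le_one)
    zero_le_one
  simp only [one_smul, zero_smul, add_zero] at h
  linarith

open Finset in
theorem norm_sum_sq_le {ι E : Type*} [SeminormedAddCommGroup E] (s : Finset ι) (v : ι → E) :
    ‖∑ i ∈ s, v i‖ ^ 2 ≤ (#s : ℝ) * ∑ i ∈ s, ‖v i‖ ^ 2 :=
  (pow_le_pow_left₀ (norm_nonneg _) (norm_sum_le _ _) 2).trans sq_sum_le_card_mul_sum_sq

section InnerLoop

variable {E : Type*} [NormedAddCommGroup E] [InnerProductSpace ℝ E]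

open Finset

theorem sub_eq_neg_smul_sum_Ico {l : ℕ} {η : ℝ} {x v : ℕ → E}
    (hx : ∀ t < l, x (t + 1) = x t - η • v t) {s t : ℕ} (hst : s ≤ t) (htl : t ≤ l) :
    x t - x s = -η • ∑ r ∈ Ico s t, v r := by
  induction t, hst using Nat.le_induction with
  | base => simp
  | succ t hst ih =>
    rw [sum_Ico_succ_top hst, smul_add, ← ih (by omega), hx t (by omega), neg_smul]
    abel

theorem norm_iterate_sub_sq_le {l : ℕ} {η : ℝ} {x v : ℕ → E}
    (hx : ∀ t < l, x (t + 1) = x t - η • v t) {s t : ℕ} (hsl : s ≤ l) (htl : t ≤ l) :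
    ‖x t - x s‖ ^ 2 ≤ η ^ 2 * l * ∑ r ∈ range l, ‖v r‖ ^ 2 := by
  wlog hst : s ≤ t generalizing s t
  · rw [norm_sub_rev]
    exact this htl hsl (le_of_not_ge hst)
  rw [sub_eq_neg_smul_sum_Ico hx hst htl, norm_smul, mul_pow, norm_neg, Real.norm_eq_abs, sq_abs,
    mul_assoc]
  refine mul_le_mul_of_nonneg_left ((norm_sum_sq_le _ _).trans ?_) (sq_nonneg η)
  have hsub : Ico s t ⊆ range l := fun r hr ↦ by
    rw [mem_Ico] at hr
    exact mem_range.mpr (by omega)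
  have hcard : #(Ico s t) ≤ l := by
    rw [Nat.card_Ico]
    omega
  gcongr

theorem norm_sub_average_sq_le {l : ℕ} (hl : 0 < l) {η : ℝ} {x v : ℕ → E}
    (hx : ∀ t < l, x (t + 1) = x t - η • v t) :
    ‖x l - (1 / (l : ℝ)) • ∑ t ∈ range l, x t‖ ^ 2 ≤ η ^ 2 * l * ∑ r ∈ range l, ‖v r‖ ^ 2 := by
  have hl' : (l : ℝ) ≠ 0 := by positivity
  have havg : x l - (1 / (l : ℝ)) • ∑ t ∈ range l, x t
      = (1 / (l : ℝ)) • ∑ t ∈ range l, (x l - x t) := by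
    rw [sum_sub_distrib, smul_sub, sum_const, card_range, ← Nat.cast_smul_eq_nsmul ℝ, smul_smul,
      one_div_mul_cancel hl', one_smul]
  rw [havg, norm_smul, mul_pow, Real.norm_eq_abs, sq_abs]
  have hsum : ∑ t ∈ range l, ‖x l - x t‖ ^ 2
      ≤ l * (η ^ 2 * l * ∑ r ∈ range l, ‖v r‖ ^ 2) := by
    simpa using sum_le_card_nsmul (range l) (fun t ↦ ‖x l - x t‖ ^ 2) _
      fun t ht ↦ norm_iterate_sub_sq_le hx (mem_range.mp ht).le le_rfl
  have h := (norm_sum_sq_le (range l) fun t ↦ x l - x t).trans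
    (mul_le_mul_of_nonneg_left hsum (Nat.cast_nonneg _))
  rw [card_range] at h
  refine (mul_le_mul_of_nonneg_left h (sq_nonneg (1 / (l : ℝ)))).trans_eq ?_
  field_simp

/-- Variance bound for a control-variate gradient estimator. -/
theorem sum_norm_add_sq_le_s16 {n : ℕ} (w : Fin n → E) (p q : E)
    (hw : ∑ a, w a = (n : ℝ) • (p - q)) :
    ∑ a, ‖w a + q‖ ^ 2 ≤ n * ‖p‖ ^ 2 + ∑ a, ‖w a‖ ^ 2 := by
  have h : ∑ a, ‖w a + q‖ ^ 2 = ∑ a, ‖w a‖ ^ 2 + 2 * inner ℝ (∑ a, w a) q + n * ‖q‖ ^ 2 := by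
    simp_rw [norm_add_sq_real, sum_add_distrib]
    rw [sum_inner, mul_sum]
    simp
  rw [h, hw, real_inner_smul_left, inner_sub_left, real_inner_self_eq_norm_sq]
  have h1 := norm_sub_sq_real p q
  nlinarith [sq_nonneg ‖p - q‖, (Nat.cast_nonneg n : (0 : ℝ) ≤ n)]

variable {Ω : Type*} [Fintype Ω] {n l : ℕ} {L η : ℝ} {x v : Ω → ℕ → E} {θ : Ω → Fin n → E}
  {G : E → E}

theorem sum_sq_norm_step_le (hn : 0 < n)
    (hsmall : 2 * L ^ 2 * η ^ 2 * (l : ℝ) ^ 2 < 1)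
    (hx : ∀ σ, ∀ t < l, x σ (t + 1) = x σ t - η • v σ t)
    (hvar : ∀ t < l, ∑ σ, ‖v σ t‖ ^ 2 ≤
      ∑ σ, (‖G (x σ t)‖ ^ 2 + L ^ 2 * (1 / (n : ℝ) * ∑ i, ‖x σ t - θ σ i‖ ^ 2))) :
    ∑ σ, ∑ t ∈ range l, ‖v σ t‖ ^ 2 ≤ 1 / (1 - 2 * L ^ 2 * η ^ 2 * (l : ℝ) ^ 2) *
      (∑ σ, ∑ t ∈ range l, ‖G (x σ t)‖ ^ 2 +
        2 * L ^ 2 * l * ∑ σ, 1 / (n : ℝ) * ∑ i, ‖x σ 0 - θ σ i‖ ^ 2) := by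
  have hn' : (n : ℝ) ≠ 0 := by positivity
  have hdist (σ : Ω) (t : ℕ) (ht : t < l) : 1 / (n : ℝ) * ∑ i, ‖x σ t - θ σ i‖ ^ 2 ≤
      2 * (η ^ 2 * l * ∑ r ∈ range l, ‖v σ r‖ ^ 2)
        + 2 * (1 / (n : ℝ) * ∑ i, ‖x σ 0 - θ σ i‖ ^ 2) := by
    have h (i : Fin n) : ‖x σ t - θ σ i‖ ^ 2 ≤
        2 * (η ^ 2 * l * ∑ r ∈ range l, ‖v σ r‖ ^ 2) + 2 * ‖x σ 0 - θ σ i‖ ^ 2 := by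
      have h1 := norm_add_le (x σ t - x σ 0) (x σ 0 - θ σ i)
      rw [sub_add_sub_cancel] at h1
      have h2 := norm_iterate_sub_sq_le (hx σ) (Nat.zero_le l) ht.le
      nlinarith [norm_nonneg (x σ t - θ σ i), sq_nonneg (‖x σ t - x σ 0‖ - ‖x σ 0 - θ σ i‖)]
    refine (mul_le_mul_of_nonneg_left (sum_le_sum fun i _ ↦ h i) (by positivity)).trans_eq ?_
    rw [sum_add_distrib, sum_const, card_univ, Fintype.card_fin, nsmul_eq_mul, ← mul_sum]
    field_simp
  rw [one_div_mul_eq_div, le_div_iff₀ (by linarith)]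
  have h : ∑ t ∈ range l, ∑ σ, ‖v σ t‖ ^ 2 ≤ ∑ t ∈ range l, ∑ σ, (‖G (x σ t)‖ ^ 2 +
      L ^ 2 * (2 * (η ^ 2 * l * ∑ r ∈ range l, ‖v σ r‖ ^ 2)
        + 2 * (1 / (n : ℝ) * ∑ i, ‖x σ 0 - θ σ i‖ ^ 2))) := by
    refine sum_le_sum fun t ht ↦ (hvar t (mem_range.mp ht)).trans (sum_le_sum fun σ _ ↦ ?_)
    gcongr
    exact hdist σ t (mem_range.mp ht)
  rw [sum_comm, sum_comm (s := range l)] at h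
  simp only [mul_add, sum_add_distrib, sum_const, card_range, nsmul_eq_mul, ← mul_sum] at h
  rw [← mul_sum]
  linarith

theorem sum_objective_le [CompleteSpace E] {F : E → ℝ} (hF : ∀ x, HasGradientAt F (G x) x)
    (hG : ∀ x y, ‖G x - G y‖ ≤ L * ‖x - y‖)
    (hx : ∀ σ, ∀ t < l, x σ (t + 1) = x σ t - η • v σ t)
    (hmean : ∀ t < l, ∑ σ, inner ℝ (G (x σ t)) (v σ t) = ∑ σ, ‖G (x σ t)‖ ^ 2) :
    ∑ σ, F (x σ l) ≤ ∑ σ, F (x σ 0) - η * ∑ σ, ∑ t ∈ range l, ‖G (x σ t)‖ ^ 2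
      + L / 2 * η ^ 2 * ∑ σ, ∑ t ∈ range l, ‖v σ t‖ ^ 2 := by
  have hstep (t : ℕ) (ht : t < l) : ∑ σ, F (x σ (t + 1)) - ∑ σ, F (x σ t) ≤
      -(η * ∑ σ, ‖G (x σ t)‖ ^ 2) + L / 2 * η ^ 2 * ∑ σ, ‖v σ t‖ ^ 2 := by
    rw [← hmean t ht, mul_sum, mul_sum, ← sum_sub_distrib, ← sum_neg_distrib, ← sum_add_distrib]
    refine sum_le_sum fun σ _ ↦ ?_
    have h := le_add_inner_add_sq_of_lipschitz_gradient hF hG (x σ t) (-(η • v σ t))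
    rw [← sub_eq_add_neg, ← hx σ t ht, inner_neg_right, real_inner_smul_right, norm_neg,
      norm_smul, mul_pow, Real.norm_eq_abs, sq_abs] at h
    linarith
  have h := sum_le_sum fun t ht ↦ hstep t (mem_range.mp ht)
  rw [sum_range_sub (fun t ↦ ∑ σ, F (x σ t)), sum_add_distrib, sum_neg_distrib, ← mul_sum,
    ← mul_sum, sum_comm, sum_comm (s := range l)] at h
  linarith

theorem sum_dist_snapshot_le (hn : 0 < n) (hη : 0 < η) {γ : ℝ} (hγ : 0 < γ)
    (hx : ∀ σ, ∀ t < l, x σ (t + 1) = x σ t - η • v σ t)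
    (hmean : ∀ t < l, ∀ i, ∑ σ, inner ℝ (x σ 0 - θ σ i) (v σ t) =
      ∑ σ, inner ℝ (x σ 0 - θ σ i) (G (x σ t))) :
    ∑ σ, 1 / (n : ℝ) * ∑ i, ‖x σ l - θ σ i‖ ^ 2 ≤
      (1 + γ * η * l) * ∑ σ, 1 / (n : ℝ) * ∑ i, ‖x σ 0 - θ σ i‖ ^ 2
        + η / γ * ∑ σ, ∑ t ∈ range l, ‖G (x σ t)‖ ^ 2
        + η ^ 2 * l * ∑ σ, ∑ t ∈ range l, ‖v σ t‖ ^ 2 := by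
  have hn' : (n : ℝ) ≠ 0 := by positivity
  have hyoung (p q : E) : -(2 * η * inner ℝ p q) ≤ γ * η * ‖p‖ ^ 2 + η / γ * ‖q‖ ^ 2 := by
    have h1 := neg_le_of_abs_le (abs_real_inner_le_norm p q)
    have h2 : 0 ≤ η / γ * (γ * ‖p‖ - ‖q‖) ^ 2 := by positivity
    have h3 : η / γ * (γ * ‖p‖ - ‖q‖) ^ 2
        = γ * η * ‖p‖ ^ 2 + η / γ * ‖q‖ ^ 2 - 2 * η * (‖p‖ * ‖q‖) := by
      field_simp
      ring
    nlinarith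
  have hdist (i : Fin n) : ∑ σ, ‖x σ l - θ σ i‖ ^ 2 ≤
      (1 + γ * η * l) * ∑ σ, ‖x σ 0 - θ σ i‖ ^ 2
        + η / γ * ∑ σ, ∑ t ∈ range l, ‖G (x σ t)‖ ^ 2
        + η ^ 2 * l * ∑ σ, ∑ t ∈ range l, ‖v σ t‖ ^ 2 := by
    have hexpand (σ : Ω) : ‖x σ l - θ σ i‖ ^ 2 = ‖x σ l - x σ 0‖ ^ 2 + ‖x σ 0 - θ σ i‖ ^ 2
        - 2 * η * ∑ t ∈ range l, inner ℝ (x σ 0 - θ σ i) (v σ t) := by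
      rw [← sub_add_sub_cancel (x σ l) (x σ 0), norm_add_sq_real, real_inner_comm]
      nth_rw 2 [sub_eq_neg_smul_sum_Ico (hx σ) (Nat.zero_le l) le_rfl]
      rw [real_inner_smul_right, inner_sum, Nat.Ico_zero_eq_range]
      ring
    have hcross : -(2 * η * ∑ σ, ∑ t ∈ range l, inner ℝ (x σ 0 - θ σ i) (v σ t)) ≤
        γ * η * l * ∑ σ, ‖x σ 0 - θ σ i‖ ^ 2
          + η / γ * ∑ σ, ∑ t ∈ range l, ‖G (x σ t)‖ ^ 2 := by
      rw [sum_comm, sum_congr rfl fun t ht ↦ hmean t (mem_range.mp ht) i, sum_comm]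
      simp_rw [mul_sum, ← sum_neg_distrib, ← sum_add_distrib]
      refine sum_le_sum fun σ _ ↦ ?_
      refine (sum_le_sum fun t _ ↦ hyoung _ _).trans_eq ?_
      rw [sum_add_distrib, sum_const, card_range, nsmul_eq_mul]
      ring
    have hdisp := sum_le_sum fun σ (_ : σ ∈ univ) ↦
      norm_iterate_sub_sq_le (hx σ) (Nat.zero_le l) le_rfl
    rw [← mul_sum] at hdisp
    simp_rw [hexpand]
    rw [sum_sub_distrib, sum_add_distrib, ← mul_sum]
    linarith
  have h := mul_le_mul_of_nonneg_left (sum_le_sum fun i (_ : i ∈ univ) ↦ hdist i)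
    (by positivity : 0 ≤ 1 / (n : ℝ))
  simp_rw [sum_add_distrib, sum_const, card_univ, Fintype.card_fin, nsmul_eq_mul, ← mul_sum] at h
  rw [sum_comm, sum_comm (s := univ (α := Fin n))] at h
  rw [← mul_sum, ← mul_sum]
  refine h.trans_eq ?_
  field_simp

/-- One outer loop decreases the Lyapunov function in expectation. -/
theorem sum_lyapunov_le [CompleteSpace E] {F : E → ℝ} {x' : Ω → E} {θ' : Ω → Fin n → E}
    (hF : ∀ x, HasGradientAt F (G x) x)
    (hG : ∀ x y, ‖G x - G y‖ ≤ L * ‖x - y‖) (hn : 0 < n) (hl : 0 < l) (hln : l ≤ n)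
    (hL : 0 < L) (hη : 0 < η) {γ : ℝ} (hγ : 0 < γ)
    (hsmall : 2 * L ^ 2 * η ^ 2 * (l : ℝ) ^ 2 < 1)
    {b c : ℝ} (hb : b = 1 / (1 - 2 * L ^ 2 * η ^ 2 * (l : ℝ) ^ 2)) (hc : 0 ≤ c)
    (hx : ∀ σ, ∀ t < l, x σ (t + 1) = x σ t - η • v σ t)
    (hx' : ∀ σ, x' σ = x σ l)
    (hmeanG : ∀ t < l, ∑ σ, inner ℝ (G (x σ t)) (v σ t) = ∑ σ, ‖G (x σ t)‖ ^ 2)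
    (hmeanθ : ∀ t < l, ∀ i, ∑ σ, inner ℝ (x σ 0 - θ σ i) (v σ t) =
      ∑ σ, inner ℝ (x σ 0 - θ σ i) (G (x σ t)))
    (hvar : ∀ t < l, ∑ σ, ‖v σ t‖ ^ 2 ≤
      ∑ σ, (‖G (x σ t)‖ ^ 2 + L ^ 2 * (1 / (n : ℝ) * ∑ i, ‖x σ t - θ σ i‖ ^ 2)))
    (hθ' : ∑ σ, ∑ i, ‖x σ l - θ' σ i‖ ^ 2 =
      ∑ σ, (l * ‖x σ l - (1 / (l : ℝ)) • ∑ t ∈ range l, x σ t‖ ^ 2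
        + (1 - (l : ℝ) / n) * ∑ i, ‖x σ l - θ σ i‖ ^ 2)) :
    ∑ σ, F (x' σ) + c * ∑ σ, 1 / (n : ℝ) * ∑ i, ‖x' σ - θ' σ i‖ ^ 2 ≤
      ∑ σ, F (x σ 0)
        + (c * (1 - (l : ℝ) / n + γ * η * l + 4 * b * η ^ 2 * L ^ 2 * (l : ℝ) ^ 2)
          + 2 * b * η ^ 2 * L ^ 3 * l) * ∑ σ, 1 / (n : ℝ) * ∑ i, ‖x σ 0 - θ σ i‖ ^ 2
        - (η - c * η / γ - b * η ^ 2 * L - 2 * b * c * η ^ 2 * l)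
          * ∑ σ, ∑ t ∈ range l, ‖G (x σ t)‖ ^ 2 := by
  have hn' : (n : ℝ) ≠ 0 := by positivity
  have hb0 : 0 < b := by
    rw [hb]
    exact one_div_pos.mpr (by linarith)
  have hV := sum_sq_norm_step_le hn hsmall hx hvar
  have hobj := sum_objective_le hF hG hx hmeanG
  have hdist := sum_dist_snapshot_le hn hη hγ hx hmeanθ
  rw [← hb] at hV
  have hnew : ∑ σ, 1 / (n : ℝ) * ∑ i, ‖x σ l - θ' σ i‖ ^ 2 ≤
      (l : ℝ) / n * (η ^ 2 * l * ∑ σ, ∑ t ∈ range l, ‖v σ t‖ ^ 2)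
        + (1 - (l : ℝ) / n) * ∑ σ, 1 / (n : ℝ) * ∑ i, ‖x σ l - θ σ i‖ ^ 2 := by
    rw [← mul_sum, hθ', sum_add_distrib, ← mul_sum, ← mul_sum, ← mul_sum]
    have h := sum_le_sum fun σ (_ : σ ∈ univ) ↦ norm_sub_average_sq_le hl (hx σ)
    rw [← mul_sum] at h
    have h1 := mul_le_mul_of_nonneg_left h (by positivity : 0 ≤ (l : ℝ) / n)
    refine (le_of_eq ?_).trans (add_le_add_left h1 _)
    field_simp
  simp_rw [hx']
  set A := ∑ σ, ∑ t ∈ range l, ‖G (x σ t)‖ ^ 2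
  set V := ∑ σ, ∑ t ∈ range l, ‖v σ t‖ ^ 2
  set H := ∑ σ, 1 / (n : ℝ) * ∑ i, ‖x σ 0 - θ σ i‖ ^ 2
  set H₁ := ∑ σ, 1 / (n : ℝ) * ∑ i, ‖x σ l - θ σ i‖ ^ 2
  set H₂ := ∑ σ, 1 / (n : ℝ) * ∑ i, ‖x σ l - θ' σ i‖ ^ 2
  have hA : 0 ≤ A := by positivity
  have hH : 0 ≤ H := by positivity
  have hr0 : 0 ≤ (l : ℝ) / n := by positivity
  have hr1 : (l : ℝ) / n ≤ 1 := (div_le_one (by positivity)).mpr (by exact_mod_cast hln)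
  set r := (l : ℝ) / n
  have hV2 : V ≤ 2 * b * A + 4 * b * L ^ 2 * l * H := by
    have : 0 ≤ b * A := by positivity
    have : 0 ≤ b * (2 * L ^ 2 * l * H) := by positivity
    linarith
  have hH2 : H₂ ≤ (1 - r + γ * η * l) * H + η / γ * A + η ^ 2 * l * V := by
    have h1 := mul_le_mul_of_nonneg_left hdist (sub_nonneg.mpr hr1)
    have h2 : 0 ≤ r * (γ * η * l * H) := by positivity
    have h3 : 0 ≤ r * (η / γ * A) := by positivity
    linarith
  have h1 := mul_le_mul_of_nonneg_left hH2 hc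
  have h2 := mul_le_mul_of_nonneg_left hV2 (by positivity : 0 ≤ L / 2 * η ^ 2)
  have h3 := mul_le_mul_of_nonneg_left hV2 (by positivity : 0 ≤ c * (η ^ 2 * l))
  have h4 : c * η / γ = c * (η / γ) := mul_div_assoc _ _ _
  rw [h4]
  linarith

end InnerLoop

section Sampling

open Finset

/-- The randomness of `M` outer loops: index tuples and snapshot subsets. -/
abbrev KSVRGSample (n l M : ℕ) : Type :=
  (Fin M → Fin l → Fin n) × (Fin M → {s : Finset (Fin n) // s.card = l})

theorem card_kSVRGSample (n l M : ℕ) :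
    (Fintype.card (KSVRGSample n l M) : ℝ) = ((n : ℝ) ^ l * (n.choose l : ℝ)) ^ M := by
  simp [Fintype.card_prod, mul_pow]

theorem sum_resample_index {n l M : ℕ} (m : Fin M) (t : Fin l)
    (Ψ : KSVRGSample n l M → Fin n → ℝ)
    (hΨ : ∀ σ a b, Ψ (Function.update σ.1 m (Function.update (σ.1 m) t a), σ.2) b = Ψ σ b) :
    (n : ℝ) * ∑ σ, Ψ σ (σ.1 m t) = ∑ σ, ∑ a, Ψ σ a := by
  have h := sum_resample (fun σ : KSVRGSample n l M ↦ σ.1 m t)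
    (fun σ a ↦ (Function.update σ.1 m (Function.update (σ.1 m) t a), σ.2))
    (by simp) (by simp) (by simp) Ψ hΨ
  simpa using h

theorem sum_resample_subset {n l M : ℕ} (m : Fin M)
    (Ψ : KSVRGSample n l M → {s : Finset (Fin n) // s.card = l} → ℝ)
    (hΨ : ∀ σ a b, Ψ (σ.1, Function.update σ.2 m a) b = Ψ σ b) :
    (n.choose l : ℝ) * ∑ σ, Ψ σ (σ.2 m) = ∑ σ, ∑ a, Ψ σ a := by
  have h := sum_resample (fun σ : KSVRGSample n l M ↦ σ.2 m)
    (fun σ a ↦ (σ.1, Function.update σ.2 m a))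
    (by simp) (by simp) (by simp) Ψ hΨ
  simpa using h

variable {E : Type*} [NormedAddCommGroup E] [InnerProductSpace ℝ E] {n l M : ℕ} {η : ℝ}
  {g : Fin n → E → E} {X : KSVRGSample n l M → ℕ → ℕ → E} {θ : KSVRGSample n l M → ℕ → Fin n → E}
  {xtil : KSVRGSample n l M → ℕ → E}

/-- The inner iterates depend only on the state at the start of the outer loop and on the
indices drawn so far. -/
theorem inner_iterate_congr
    (hXstep : ∀ σ (m : Fin M) (t : Fin l),
      X σ m.val (t.val + 1) = X σ m.val t.val -
        η • (g (σ.1 m t) (X σ m.val t.val) - g (σ.1 m t) (θ σ m.val (σ.1 m t))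
          + (1 / (n : ℝ)) • ∑ j, g j (θ σ m.val j)))
    {σ τ : KSVRGSample n l M} {m : Fin M} (h0 : X σ m 0 = X τ m 0) (hθ : θ σ m = θ τ m)
    {t : ℕ} (ht : t ≤ l) (h : ∀ s : Fin l, s.val < t → σ.1 m s = τ.1 m s) :
    X σ m t = X τ m t := by
  induction t with
  | zero => exact h0
  | succ t ih =>
    have hprev := ih (by omega) fun s hs ↦ h s (by omega)
    have hidx := h ⟨t, ht⟩ (Nat.lt_succ_self t)
    have h1 := hXstep σ m ⟨t, ht⟩
    have h2 := hXstep τ m ⟨t, ht⟩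
    simp only at h1 h2
    rw [h1, h2, hprev, hidx, hθ]

/-- The state at the start of an outer loop depends only on the preceding draws. -/
theorem outer_state_congr {x0 : E}
    (hX00 : ∀ σ, X σ 0 0 = x0) (hθ0 : ∀ σ i, θ σ 0 i = x0)
    (hXstep : ∀ σ (m : Fin M) (t : Fin l),
      X σ m.val (t.val + 1) = X σ m.val t.val -
        η • (g (σ.1 m t) (X σ m.val t.val) - g (σ.1 m t) (θ σ m.val (σ.1 m t))
          + (1 / (n : ℝ)) • ∑ j, g j (θ σ m.val j)))
    (hxtil : ∀ σ (m : Fin M),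
      xtil σ (m.val + 1) = (1 / (l : ℝ)) • ∑ t ∈ range l, X σ m.val t)
    (hXnext : ∀ σ (m : Fin M), X σ (m.val + 1) 0 = X σ m.val l)
    (hθstep : ∀ σ (m : Fin M) (i : Fin n),
      θ σ (m.val + 1) i = if i ∈ (σ.2 m).val then xtil σ (m.val + 1) else θ σ m.val i)
    {σ τ : KSVRGSample n l M} {m : ℕ} (hm : m ≤ M)
    (h : ∀ k : Fin M, k.val < m → σ.1 k = τ.1 k ∧ σ.2 k = τ.2 k) :
    X σ m 0 = X τ m 0 ∧ θ σ m = θ τ m := by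
  induction m with
  | zero => exact ⟨by rw [hX00, hX00], funext fun i ↦ by rw [hθ0, hθ0]⟩
  | succ m ih =>
    obtain ⟨hX, hθ⟩ := ih (by omega) fun k hk ↦ h k (by omega)
    obtain ⟨hω, hΦ⟩ := h ⟨m, hm⟩ (Nat.lt_succ_self m)
    have hinner (t : ℕ) (ht : t ≤ l) : X σ m t = X τ m t :=
      inner_iterate_congr (m := ⟨m, hm⟩) hXstep hX hθ ht fun s _ ↦ by rw [hω]
    have hx : xtil σ (m + 1) = xtil τ (m + 1) := by
      rw [hxtil σ ⟨m, hm⟩, hxtil τ ⟨m, hm⟩]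
      exact congrArg _ (sum_congr rfl fun t ht ↦ hinner t (mem_range.mp ht).le)
    refine ⟨?_, funext fun i ↦ ?_⟩
    · rw [hXnext σ ⟨m, hm⟩, hXnext τ ⟨m, hm⟩]
      exact hinner l le_rfl
    · rw [hθstep σ ⟨m, hm⟩, hθstep τ ⟨m, hm⟩, hΦ, hx, hθ]

end Sampling


/-- Theorem 3, first part: non-convex convergence of `k`-SVRG-V2 over `M` outer loops.
The full randomness consists of `M` independent uniform tuples `ω^m ∈ {1,…,n}^ℓ` and
`M` independent uniform `ℓ`-element subsets `Φ^m ⊆ {1,…,n}`; expectation is the uniform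
average over this product sample space. -/
theorem kSVRG_nonconvex_convergence {E : Type*} [NormedAddCommGroup E]
    [InnerProductSpace ℝ E] [CompleteSpace E]
    (n l : ℕ) (hn : 0 < n) (hl : 0 < l) (hln : l ≤ n) (L : ℝ) (hL : 0 < L)
    (f : Fin n → E → ℝ) (g : Fin n → E → E)
    (hgrad : ∀ i x, HasGradientAt (f i) (g i x) x)
    (hsmooth : ∀ i x y, ‖g i x - g i y‖ ≤ L * ‖x - y‖)
    (F : E → ℝ) (hF : ∀ x, F x = (1 / (n : ℝ)) * ∑ i, f i x)
    (G : E → E) (hG : ∀ x, G x = (1 / (n : ℝ)) • ∑ i, g i x)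
    (fstar : ℝ) (hfstar : ∀ x, fstar ≤ F x)
    (η : ℝ) (hη : 0 < η) (hsmall : 2 * L ^ 2 * η ^ 2 * (l : ℝ) ^ 2 < 1)
    (b1 : ℝ) (hb1 : b1 = 1 / (1 - 2 * L ^ 2 * η ^ 2 * (l : ℝ) ^ 2))
    (γ : ℝ) (hγ : 0 < γ)
    (M : ℕ) (hM : 0 < M)
    (c : ℕ → ℝ) (hcM : c M = 0)
    (hc : ∀ m < M, c m = c (m + 1) * (1 - (l : ℝ) / (n : ℝ) + γ * η * (l : ℝ)
        + 4 * b1 * η ^ 2 * L ^ 2 * (l : ℝ) ^ 2) + 2 * b1 * η ^ 2 * L ^ 3 * (l : ℝ))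
    (Γm : ℕ → ℝ)
    (hΓm : ∀ m < M, Γm m = η - c (m + 1) * η / γ - b1 * η ^ 2 * L
        - 2 * b1 * c (m + 1) * η ^ 2 * (l : ℝ))
    (hΓpos : ∀ m < M, 0 < Γm m)
    (x0 : E)
    (X : ((Fin M → Fin l → Fin n) × (Fin M → {s : Finset (Fin n) // s.card = l})) →
      ℕ → ℕ → E)
    (θ : ((Fin M → Fin l → Fin n) × (Fin M → {s : Finset (Fin n) // s.card = l})) →
      ℕ → Fin n → E)
    (xtil : ((Fin M → Fin l → Fin n) × (Fin M → {s : Finset (Fin n) // s.card = l})) →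
      ℕ → E)
    (hX00 : ∀ σ, X σ 0 0 = x0)
    (hθ0 : ∀ σ i, θ σ 0 i = x0)
    (hXstep : ∀ σ (m : Fin M) (t : Fin l),
      X σ m.val (t.val + 1) = X σ m.val t.val -
        η • (g (σ.1 m t) (X σ m.val t.val) - g (σ.1 m t) (θ σ m.val (σ.1 m t))
          + (1 / (n : ℝ)) • ∑ j, g j (θ σ m.val j)))
    (hxtil : ∀ σ (m : Fin M),
      xtil σ (m.val + 1) = (1 / (l : ℝ)) • ∑ t ∈ Finset.range l, X σ m.val t)
    (hXnext : ∀ σ (m : Fin M), X σ (m.val + 1) 0 = X σ m.val l)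
    (hθstep : ∀ σ (m : Fin M) (i : Fin n),
      θ σ (m.val + 1) i =
        if i ∈ (σ.2 m).val then xtil σ (m.val + 1) else θ σ m.val i) :
    ∑ m ∈ Finset.range M,
        ((1 / ((n : ℝ) ^ l * (n.choose l : ℝ))) ^ M *
          ∑ σ : (Fin M → Fin l → Fin n) × (Fin M → {s : Finset (Fin n) // s.card = l}),
            ∑ t ∈ Finset.range l, ‖G (X σ m t)‖ ^ 2) ≤
      (F x0 - fstar) /
        ((Finset.range M).inf' (Finset.nonempty_range_iff.mpr hM.ne') Γm) := by
  have hn' : (n : ℝ) ≠ 0 := by positivity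
  have hGsum (x : E) : ∑ i, g i x = (n : ℝ) • G x := by
    rw [hG, smul_smul, mul_one_div_cancel hn', one_smul]
  have hFgrad (x : E) : HasGradientAt F (G x) x := by
    have h : HasGradientAt (fun x ↦ (1 / (n : ℝ)) * ∑ i, f i x) ((1 / (n : ℝ)) • ∑ i, g i x) x := by
      rw [hasGradientAt_iff_hasFDerivAt, map_smul, map_sum]
      exact (HasFDerivAt.fun_sum fun i _ ↦ (hgrad i x).hasFDerivAt).const_mul _
    rw [hG, funext hF]
    exact h
  have hGlip (x y : E) : ‖G x - G y‖ ≤ L * ‖x - y‖ := by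
    rw [hG, hG, ← smul_sub, ← Finset.sum_sub_distrib, norm_smul, Real.norm_of_nonneg (by positivity),
      one_div_mul_eq_div, div_le_iff₀ (by positivity)]
    refine (norm_sum_le_of_le _ fun i _ ↦ hsmooth i x y).trans_eq ?_
    simp [mul_comm]
  have hc0 (k : ℕ) (hk : k ≤ M) : 0 ≤ c (M - k) := by
    induction k with
    | zero => simp [hcM]
    | succ k ih =>
      have h1 := hc (M - (k + 1)) (by omega)
      rw [show M - (k + 1) + 1 = M - k by omega] at h1
      have h2 := ih (by omega)
      have hb : 0 ≤ b1 := by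
        rw [hb1]
        exact one_div_nonneg.mpr (by linarith)
      have hr : 0 ≤ 1 - (l : ℝ) / n :=
        sub_nonneg.mpr ((div_le_one (by positivity)).mpr (by exact_mod_cast hln))
      rw [h1]
      positivity
  set A : ℕ → ℝ := fun m ↦ ∑ σ, ∑ t ∈ Finset.range l, ‖G (X σ m t)‖ ^ 2
  set P : ℕ → ℝ := fun m ↦ ∑ σ, F (X σ m 0)
    + c m * ∑ σ, 1 / (n : ℝ) * ∑ i, ‖X σ m 0 - θ σ m i‖ ^ 2 with hP
  have hloop (m : ℕ) (hm : m < M) : P (m + 1) ≤ P m - Γm m * A m := by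
    have hc1 : 0 ≤ c (m + 1) := by
      simpa [show M - (M - (m + 1)) = m + 1 by omega] using hc0 (M - (m + 1)) (by omega)
    let k : Fin M := ⟨m, hm⟩
    let dir (σ : KSVRGSample n l M) (t : ℕ) (a : Fin n) : E :=
      g a (X σ m t) - g a (θ σ m a) + (1 / (n : ℝ)) • ∑ j, g j (θ σ m j)
    have hdirsum (σ : KSVRGSample n l M) (t : ℕ) :
        ∑ a, (g a (X σ m t) - g a (θ σ m a)) =
          (n : ℝ) • (G (X σ m t) - (1 / (n : ℝ)) • ∑ j, g j (θ σ m j)) := by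
      rw [Finset.sum_sub_distrib, hGsum, smul_sub, smul_smul, mul_one_div_cancel hn', one_smul]
    have hdirmean (σ : KSVRGSample n l M) (t : ℕ) : ∑ a, dir σ t a = (n : ℝ) • G (X σ m t) := by
      rw [Finset.sum_add_distrib, hdirsum, Finset.sum_const, Finset.card_univ, Fintype.card_fin,
        ← Nat.cast_smul_eq_nsmul ℝ, ← smul_add, sub_add_cancel]
    let v (σ : KSVRGSample n l M) (t : ℕ) : E := η⁻¹ • (X σ m t - X σ m (t + 1))
    have hv (σ : KSVRGSample n l M) (t : Fin l) : v σ t = dir σ t (σ.1 k t) := by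
      have h := hXstep σ k t
      simp only [v, dir]
      rw [show X σ m (t + 1) = _ from h, sub_sub_cancel, smul_smul, inv_mul_cancel₀ hη.ne', one_smul]
    have hstart (σ : KSVRGSample n l M) (t : Fin l) (a : Fin n) :
        X (Function.update σ.1 k (Function.update (σ.1 k) t a), σ.2) m 0 = X σ m 0 ∧
        θ (Function.update σ.1 k (Function.update (σ.1 k) t a), σ.2) m = θ σ m := by
      refine outer_state_congr hX00 hθ0 hXstep hxtil hXnext hθstep hm.le fun j hj ↦ ⟨?_, rfl⟩
      exact Function.update_of_ne (Fin.ne_of_lt hj) _ _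
    have hinner (σ : KSVRGSample n l M) (t : Fin l) (a : Fin n) :
        X (Function.update σ.1 k (Function.update (σ.1 k) t a), σ.2) m t = X σ m t := by
      refine inner_iterate_congr (m := k) hXstep (hstart σ t a).1 (hstart σ t a).2 t.isLt.le
        fun s hs ↦ ?_
      simp [Fin.ne_of_lt (show s < t from hs)]
    have hdir (σ : KSVRGSample n l M) (t : Fin l) (a b : Fin n) :
        dir (Function.update σ.1 k (Function.update (σ.1 k) t a), σ.2) t b = dir σ t b := by
      simp only [dir, hinner, hstart]
    have hmean (t : Fin l) (u : KSVRGSample n l M → E)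
        (hu : ∀ σ a, u (Function.update σ.1 k (Function.update (σ.1 k) t a), σ.2) = u σ) :
        ∑ σ, inner ℝ (u σ) (v σ t) = ∑ σ, inner ℝ (u σ) (G (X σ m t)) := by
      have h := sum_resample_index k t (fun σ a ↦ inner ℝ (u σ) (dir σ t a))
        (fun σ a b ↦ by simp only [hdir, hu])
      simp_rw [← inner_sum, hdirmean, real_inner_smul_right, ← Finset.mul_sum] at h
      simp_rw [hv]
      exact mul_left_cancel₀ hn' h
    have hvar (t : Fin l) : ∑ σ, ‖v σ t‖ ^ 2 ≤ ∑ σ, (‖G (X σ m t)‖ ^ 2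
        + L ^ 2 * (1 / (n : ℝ) * ∑ i, ‖X σ m t - θ σ m i‖ ^ 2)) := by
      have h := sum_resample_index k t (fun σ a ↦ ‖dir σ t a‖ ^ 2)
        (fun σ a b ↦ by simp only [hdir])
      simp_rw [hv]
      refine le_of_mul_le_mul_left (h.trans_le ?_) (by positivity : (0 : ℝ) < n)
      rw [Finset.mul_sum]
      refine Finset.sum_le_sum fun σ _ ↦ (sum_norm_add_sq_le_s16 _ _ _ (hdirsum σ t)).trans ?_
      have hlip : ∑ a, ‖g a (X σ m t) - g a (θ σ m a)‖ ^ 2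
          ≤ L ^ 2 * ∑ a, ‖X σ m t - θ σ m a‖ ^ 2 := by
        rw [Finset.mul_sum]
        refine Finset.sum_le_sum fun a _ ↦ ?_
        rw [← mul_pow]
        exact pow_le_pow_left₀ (norm_nonneg _) (hsmooth a _ _) 2
      refine (add_le_add_right hlip _).trans_eq ?_
      field_simp
    have hsnapshot : ∑ σ, ∑ i, ‖X σ m l - θ σ (m + 1) i‖ ^ 2 =
        ∑ σ, (l * ‖X σ m l - (1 / (l : ℝ)) • ∑ t ∈ Finset.range l, X σ m t‖ ^ 2
          + (1 - (l : ℝ) / n) * ∑ i, ‖X σ m l - θ σ m i‖ ^ 2) := by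
      have hstart (σ : KSVRGSample n l M) (s : {s : Finset (Fin n) // s.card = l}) :
          X (σ.1, Function.update σ.2 k s) m 0 = X σ m 0 ∧
          θ (σ.1, Function.update σ.2 k s) m = θ σ m :=
        outer_state_congr hX00 hθ0 hXstep hxtil hXnext hθstep hm.le fun j hj ↦
          ⟨rfl, Function.update_of_ne (Fin.ne_of_lt hj) _ _⟩
      have hinner (σ : KSVRGSample n l M) (s : {s : Finset (Fin n) // s.card = l}) (t : ℕ)
          (ht : t ≤ l) : X (σ.1, Function.update σ.2 k s) m t = X σ m t :=
        inner_iterate_congr (m := k) hXstep (hstart σ s).1 (hstart σ s).2 ht fun _ _ ↦ rfl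
      have havg (σ : KSVRGSample n l M) (s : {s : Finset (Fin n) // s.card = l}) :
          ∑ t ∈ Finset.range l, X (σ.1, Function.update σ.2 k s) m t =
            ∑ t ∈ Finset.range l, X σ m t :=
        Finset.sum_congr rfl fun t ht ↦ hinner σ s t (Finset.mem_range.mp ht).le
      have h := sum_resample_subset k (fun σ s ↦ ∑ i, if i ∈ s.val then
          ‖X σ m l - (1 / (l : ℝ)) • ∑ t ∈ Finset.range l, X σ m t‖ ^ 2
        else ‖X σ m l - θ σ m i‖ ^ 2)
        (fun σ a b ↦ by simp only [hinner _ _ l le_rfl, havg, hstart])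
      simp_rw [sum_subtype_ite_mem hn hl, ← Finset.mul_sum] at h
      have hchoose : (n.choose l : ℝ) ≠ 0 := by
        exact_mod_cast (Nat.choose_pos hln).ne'
      rw [← mul_left_cancel₀ hchoose h]
      refine Finset.sum_congr rfl fun σ _ ↦ Finset.sum_congr rfl fun i _ ↦ ?_
      rw [hθstep σ k, hxtil σ k]
      split_ifs <;> rfl
    have h := sum_lyapunov_le (x := fun σ ↦ X σ m) (v := v) (θ := fun σ ↦ θ σ m)
      (x' := fun σ ↦ X σ (m + 1) 0) (θ' := fun σ ↦ θ σ (m + 1)) hFgrad hGlip hn hl hln hL hη hγ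
      hsmall hb1 hc1
      (fun σ t _ ↦ by simp only [v]; rw [smul_inv_smul₀ hη.ne', sub_sub_cancel])
      (fun σ ↦ hXnext σ k)
      (fun t ht ↦ by
        simpa only [real_inner_self_eq_norm_sq] using
          hmean ⟨t, ht⟩ (fun σ ↦ G (X σ m t)) fun σ a ↦ congrArg G (hinner σ ⟨t, ht⟩ a))
      (fun t ht i ↦ hmean ⟨t, ht⟩ (fun σ ↦ X σ m 0 - θ σ m i) fun σ a ↦ by
        rw [(hstart σ ⟨t, ht⟩ a).1, (hstart σ ⟨t, ht⟩ a).2])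
      (fun t ht ↦ hvar ⟨t, ht⟩) hsnapshot
    rw [← hc m hm, ← hΓm m hm] at h
    exact h
  set Γ := (Finset.range M).inf' (Finset.nonempty_range_iff.mpr hM.ne') Γm
  have hΓ0 : 0 < Γ := (Finset.lt_inf'_iff _).mpr fun m hm ↦ hΓpos m (Finset.mem_range.mp hm)
  have hsum : ∑ m ∈ Finset.range M, Γ * A m ≤ P 0 - P M := by
    rw [← Finset.sum_range_sub' P]
    refine Finset.sum_le_sum fun m hm ↦ ?_
    have h1 := hloop m (Finset.mem_range.mp hm)
    have h2 : Γ * A m ≤ Γm m * A m :=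
      mul_le_mul_of_nonneg_right (Finset.inf'_le _ hm) (by positivity)
    linarith
  set N : ℝ := ((n : ℝ) ^ l * (n.choose l : ℝ)) ^ M with hN
  have hN0 : 0 < N := by
    have := Nat.choose_pos hln
    positivity
  have hcard : (Fintype.card (KSVRGSample n l M) : ℝ) = N := card_kSVRGSample n l M
  have hP0 : P 0 = N * F x0 := by
    simp only [hP, hX00, hθ0]
    rw [← hcard]
    simp
  have hPM : N * fstar ≤ P M := by
    simp only [hP, hcM, zero_mul, add_zero]
    rw [← hcard, ← nsmul_eq_mul]
    exact Finset.card_nsmul_le_sum _ _ _ fun σ _ ↦ hfstar _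
  rw [← Finset.mul_sum, le_div_iff₀ hΓ0, one_div_pow, ← hN, one_div_mul_eq_div, div_mul_eq_mul_div,
    div_le_iff₀ hN0]
  rw [← Finset.mul_sum] at hsum
  linarith
end

section
/- (Parameter computation in the proof of Theorem 3.) Let L > 0 and let n > 15 be an integer. Set η = 1/(5L·n^{2/3}), γ = L/n^{1/3}, ℓ = (3/2)·n^{1/3} (as a real number), and b₁ = 1/(1 − 2L²η²ℓ²). Let M be a positive integer, define c^M = 0 and, for m = M−1,…,0, c^m = c^{m+1}·(1 − ℓ/n + γηℓ + 4b₁η²L²ℓ²) + 2b₁η²L³ℓ, and set Γ^m = η − c^{m+1}·η/γ − b₁η²L − 2b₁c^{m+1}η²ℓ. Then: (i) b₁ ≤ 2; (ii) with λ = ℓ·(1/n − γη − 4b₁η²L²ℓ), one has 8ℓ/(25n) ≤ λ ≤ 1; (iii) c^m ≤ L/(2n^{1/3}) for all 0 ≤ m ≤ M; and (iv) Γ^m ≥ 1/(15L·n^{2/3}) for all 0 ≤ m ≤ M−1. -/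
/-- Parameter computation in the proof of Theorem 3, with
`η = 1/(5L n^{2/3})`, `γ = L/n^{1/3}`, `ℓ = (3/2)·n^{1/3}`. -/
theorem kSVRG_nonconvex_parameters (L : ℝ) (hL : 0 < L) (n : ℕ) (hn : 15 < n)
    (η γ l b1 : ℝ)
    (hη : η = 1 / (5 * L * (n : ℝ) ^ ((2 : ℝ) / 3)))
    (hγ : γ = L / (n : ℝ) ^ ((1 : ℝ) / 3))
    (hl : l = (3 / 2) * (n : ℝ) ^ ((1 : ℝ) / 3))
    (hb1 : b1 = 1 / (1 - 2 * L ^ 2 * η ^ 2 * l ^ 2))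
    (M : ℕ) (hM : 0 < M)
    (c : ℕ → ℝ) (hcM : c M = 0)
    (hc : ∀ m < M, c m = c (m + 1) * (1 - l / (n : ℝ) + γ * η * l
        + 4 * b1 * η ^ 2 * L ^ 2 * l ^ 2) + 2 * b1 * η ^ 2 * L ^ 3 * l)
    (Γm : ℕ → ℝ)
    (hΓm : ∀ m < M, Γm m = η - c (m + 1) * η / γ - b1 * η ^ 2 * L
        - 2 * b1 * c (m + 1) * η ^ 2 * l) :
    b1 ≤ 2 ∧
      (8 * l / (25 * (n : ℝ)) ≤ l * (1 / (n : ℝ) - γ * η - 4 * b1 * η ^ 2 * L ^ 2 * l) ∧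
        l * (1 / (n : ℝ) - γ * η - 4 * b1 * η ^ 2 * L ^ 2 * l) ≤ 1) ∧
      (∀ m ≤ M, c m ≤ L / (2 * (n : ℝ) ^ ((1 : ℝ) / 3))) ∧
      (∀ m < M, Γm m ≥ 1 / (15 * L * (n : ℝ) ^ ((2 : ℝ) / 3))) := by
  obtain ⟨t, ht⟩ : ∃ t : ℝ, t = (n : ℝ) ^ ((1 : ℝ) / 3) := ⟨_, rfl⟩
  have hn0 : (0 : ℝ) ≤ n := n.cast_nonneg
  have hn16 : (16 : ℝ) ≤ n := by exact_mod_cast hn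
  have ht0 : 0 < t := ht ▸ Real.rpow_pos_of_pos (by linarith) _
  have ht2 : (n : ℝ) ^ ((2 : ℝ) / 3) = t ^ 2 := by
    rw [ht, ← Real.rpow_mul_natCast hn0]; norm_num
  have ht3 : (n : ℝ) = t ^ 3 := by
    rw [ht, ← Real.rpow_mul_natCast hn0]; norm_num
  rw [ht2] at hη ⊢
  rw [← ht] at hγ hl ⊢
  rw [ht3] at hc hn16 ⊢
  have ht25 : (5 / 2 : ℝ) ≤ t := by
    by_contra! h
    have := pow_le_pow_left₀ ht0.le h.le 3
    norm_num at this
    linarith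
  have ht6 : (6 : ℝ) ≤ t ^ 2 := by nlinarith
  have hb_eq : b1 = 1 / (1 - 9 / (50 * t ^ 2)) := by
    rw [hb1, hη, hl]
    congr 2
    field_simp
    norm_num
  have hsmall : 9 / (50 * t ^ 2) ≤ (3 / 100 : ℝ) := by
    rw [div_le_iff₀ (by positivity)]
    linarith
  have hbpos : 0 < b1 := by
    rw [hb_eq]
    exact one_div_pos.mpr (by linarith)
  have hb_le : b1 ≤ 3 / 2 := by
    rw [hb_eq, div_le_iff₀ (by linarith)]
    linarith
  obtain ⟨r, hr⟩ : ∃ r : ℝ, r = l * (1 / t ^ 3 - γ * η - 4 * b1 * η ^ 2 * L ^ 2 * l) := ⟨_, rfl⟩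
  have hr_eq : r = (30 - 9 * b1) / (25 * t ^ 2) := by
    rw [hr, hη, hγ, hl]
    field_simp
    ring
  have hr_ge : 8 * l / (25 * t ^ 3) ≤ r := by
    have : 8 * l / (25 * t ^ 3) = 12 / (25 * t ^ 2) := by
      rw [hl]
      field_simp
      norm_num
    rw [this, hr_eq]
    gcongr
    linarith
  have hr_le : r ≤ 1 := by
    rw [hr_eq, div_le_one (by positivity)]
    linarith
  have hinc : 2 * b1 * η ^ 2 * L ^ 3 * l ≤ r * (L / (2 * t)) := by
    have h1 : 2 * b1 * η ^ 2 * L ^ 3 * l = L / (50 * t ^ 3) * (6 * b1) := by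
      rw [hη, hl]
      field_simp
      norm_num
    have h2 : r * (L / (2 * t)) = L / (50 * t ^ 3) * (30 - 9 * b1) := by
      rw [hr_eq]
      field_simp
      ring
    rw [h1, h2]
    gcongr
    linarith
  have hc_le : ∀ m ≤ M, c m ≤ L / (2 * t) := by
    intro m hm
    induction hm using Nat.decreasingInduction with
    | self => rw [hcM]; positivity
    | of_succ m hm ih =>
      have hstep : c m = c (m + 1) * (1 - r) + 2 * b1 * η ^ 2 * L ^ 3 * l := by
        rw [hc m hm, hr]
        ring
      have := mul_le_mul_of_nonneg_right ih (sub_nonneg.mpr hr_le)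
      linarith
  refine ⟨by linarith, hr ▸ ⟨hr_ge, hr_le⟩, hc_le, fun m hm => ?_⟩
  have hη0 : 0 < η := by rw [hη]; positivity
  have hγ0 : 0 < γ := by rw [hγ]; positivity
  have hl0 : 0 < l := by rw [hl]; positivity
  have hcoef : 0 ≤ η / γ + 2 * b1 * η ^ 2 * l := by positivity
  have hmul := mul_le_mul_of_nonneg_right (hc_le (m + 1) hm) hcoef
  have hbound : η - L / (2 * t) * (η / γ + 2 * b1 * η ^ 2 * l) - b1 * η ^ 2 * L
      = (1 / 2 - b1 / (2 * t ^ 2)) / (5 * L * t ^ 2) := by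
    rw [hη, hγ, hl]
    field_simp
    ring
  have hbt : b1 / (2 * t ^ 2) ≤ 1 / 6 := by
    rw [div_le_iff₀ (by positivity)]
    linarith
  have hfinal : 1 / (15 * L * t ^ 2) ≤ (1 / 2 - b1 / (2 * t ^ 2)) / (5 * L * t ^ 2) := by
    have : 1 / (15 * L * t ^ 2) = (1 / 3) / (5 * L * t ^ 2) := by
      field_simp
      norm_num
    rw [this]
    gcongr
    linarith
  have hΓ : Γm m = η - c (m + 1) * (η / γ + 2 * b1 * η ^ 2 * l) - b1 * η ^ 2 * L := by
    rw [hΓm m hm]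
    ring
  rw [hΓ]
  linarith
end
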